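/- arXiv:2110.07320 — 3 statements merged into one kernel-verified Lean document; each statement's English description precedes it below -/
import Mathlib

section
/- Let ρ and σ be density matrices on ℂ^d with s(ρ) ≤ s(σ), and let κ ∈ (0,1). Define the generalized κ-cutoff rate C_κ(ρ‖σ) as the infimum of all r₀ ∈ ℝ such that sc̲_r(ρ‖σ) ≥ κ(r − r₀) holds for every r ∈ ℝ. Then C_κ(ρ‖σ) = D*_{1/(1−κ)}(ρ‖σ). -/
open scoped ENNReal ComplexOrder Classical

namespace QRD

variable {n : Type*} [Fintype n] [DecidableEq n]

/-- Functional calculus for Hermitian matrices (junk value `0` otherwise). -/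
noncomputable def matFun (A : Matrix n n ℂ) (f : ℝ → ℝ) : Matrix n n ℂ :=
  if hA : A.IsHermitian then
    (hA.eigenvectorUnitary : Matrix n n ℂ) *
      Matrix.diagonal (fun i => (f (hA.eigenvalues i) : ℂ)) *
      (star (hA.eigenvectorUnitary : Matrix n n ℂ))
  else 0

/-- The support projection `s(A)` of a Hermitian matrix. -/
noncomputable def supp (A : Matrix n n ℂ) : Matrix n n ℂ :=
  matFun A (fun x => if x = 0 then 0 else 1)

/-- The functional-calculus power `A^t` taken on the support of `A`. -/
noncomputable def matPow (A : Matrix n n ℂ) (t : ℝ) : Matrix n n ℂ :=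
  matFun A (fun x => if x = 0 then 0 else x ^ t)

/-- The functional-calculus logarithm taken on the support of `A`. -/
noncomputable def matLog (A : Matrix n n ℂ) : Matrix n n ℂ :=
  matFun A Real.log

/-- `suppLE ρ σ` means `s(ρ) ≤ s(σ)`, i.e. `ker σ ⊆ ker ρ`. -/
def suppLE (ρ σ : Matrix n n ℂ) : Prop :=
  LinearMap.ker σ.mulVecLin ≤ LinearMap.ker ρ.mulVecLin

/-- Loewner order: `A ≤ B` iff `B - A` is positive semidefinite. -/
def loewnerLE (A B : Matrix n n ℂ) : Prop := (B - A).PosSemidef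

/-- A density matrix: positive semidefinite with unit trace. -/
def IsDensityMatrix (ρ : Matrix n n ℂ) : Prop := ρ.PosSemidef ∧ ρ.trace = 1

/-- The quantity `Q^*_α(ρ‖σ)`, with values in `[0,∞]`. -/
noncomputable def Qstar (α : ℝ) (ρ σ : Matrix n n ℂ) : ℝ≥0∞ :=
  if 1 < α ∧ ¬ suppLE ρ σ then ⊤
  else ENNReal.ofReal
    ((matPow (matPow σ ((1 - α) / (2 * α)) * ρ * matPow σ ((1 - α) / (2 * α))) α).trace.re)

/-- The sandwiched Rényi `α`-divergence `D^*_α(ρ‖σ)`. -/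
noncomputable def Dstar (α : ℝ) (ρ σ : Matrix n n ℂ) : EReal :=
  (((α - 1)⁻¹ : ℝ) : EReal) * (Qstar α ρ σ).log

/-- The Hoeffding anti-divergence `H^*_r(ρ‖σ)`. -/
noncomputable def Hstar (r : ℝ) (ρ σ : Matrix n n ℂ) : EReal :=
  ⨆ α ∈ Set.Ioi (1 : ℝ), ((((α - 1) / α : ℝ) : EReal) * ((r : EReal) - Dstar α ρ σ))

/-- The Umegaki relative entropy `D(ρ‖σ)`. -/
noncomputable def Drel (ρ σ : Matrix n n ℂ) : EReal :=
  if suppLE ρ σ then (((ρ * (matLog ρ - matLog σ)).trace.re : ℝ) : EReal) else ⊤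

/-- The max-relative entropy `D_max(ρ‖σ)`. -/
noncomputable def Dmax (ρ σ : Matrix n n ℂ) : EReal :=
  if ∃ γ : ℝ, 0 ≤ γ ∧ loewnerLE ρ (γ • σ) then
    ((Real.log (sInf {γ : ℝ | 0 ≤ γ ∧ loewnerLE ρ (γ • σ)}) : ℝ) : EReal)
  else ⊤

/-- The `n`-fold Kronecker tensor power of a `d × d` matrix. -/
noncomputable def tensorPow {d : ℕ} (ρ : Matrix (Fin d) (Fin d) ℂ) (N : ℕ) :
    Matrix (Fin N → Fin d) (Fin N → Fin d) ℂ :=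
  Matrix.of fun x y => ∏ i, ρ (x i) (y i)

/-- A (quantum) test: `0 ≤ T ≤ 1` in the Loewner order. -/
def IsTest {m : Type*} [Fintype m] [DecidableEq m] (T : Matrix m m ℂ) : Prop :=
  T.PosSemidef ∧ (1 - T).PosSemidef

/-- `-(1/n) log x`, with the convention `-log 0 = +∞`. -/
noncomputable def expRate (N : ℕ) (x : ℝ) : EReal :=
  if x = 0 then ⊤ else ((-(N : ℝ)⁻¹ * Real.log x : ℝ) : EReal)

end QRD

namespace QRD

/-- The strong converse exponent `sc̲_r(ρ‖σ)`: the infimum of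
`liminf_n −(1/n) log Tr(ρ^{⊗n} T_n)` over all test sequences `{T_n}` with
`liminf_n −(1/n) log Tr(σ^{⊗n} T_n) ≥ r` (with the convention `−log 0 = +∞`). -/
noncomputable def scLow {d : ℕ} (r : ℝ) (ρ σ : Matrix (Fin d) (Fin d) ℂ) : EReal :=
  sInf {x : EReal |
    ∃ T : (N : ℕ) → Matrix (Fin N → Fin d) (Fin N → Fin d) ℂ,
      (∀ N, IsTest (T N)) ∧
      (r : EReal) ≤ Filter.liminf
        (fun N => expRate N ((tensorPow σ N * T N).trace.re)) Filter.atTop ∧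
      x = Filter.liminf
        (fun N => expRate N ((tensorPow ρ N * T N).trace.re)) Filter.atTop}

/-- The generalized `κ`-cutoff rate `C_κ(ρ‖σ)`: the infimum of all `r₀ ∈ ℝ` such that
`sc̲_r(ρ‖σ) ≥ κ(r − r₀)` holds for every `r ∈ ℝ`. -/
noncomputable def cutoffRate {d : ℕ} (κ : ℝ) (ρ σ : Matrix (Fin d) (Fin d) ℂ) : EReal :=
  sInf ((fun r₀ : ℝ => (r₀ : EReal)) ''
    {r₀ : ℝ | ∀ r : ℝ, ((κ * (r - r₀) : ℝ) : EReal) ≤ scLow r ρ σ})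

end QRD

namespace QRD

open Matrix Finset

section Spectral

variable {m : Type*} [Fintype m] [DecidableEq m]

/-- The matrix `U diag(f) Uᴴ`. -/
noncomputable def unitaryDiag (U : Matrix m m ℂ) (f : m → ℝ) : Matrix m m ℂ :=
  U * diagonal (fun i => (f i : ℂ)) * Uᴴ

theorem conjTranspose_mul_self_of_mem_unitary {U : Matrix m m ℂ}
    (hU : U ∈ unitaryGroup m ℂ) : Uᴴ * U = 1 :=
  mem_unitaryGroup_iff'.1 hU

theorem self_mul_conjTranspose_of_mem_unitary {U : Matrix m m ℂ}
    (hU : U ∈ unitaryGroup m ℂ) : U * Uᴴ = 1 :=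
  mem_unitaryGroup_iff.1 hU

theorem unitaryDiag_mul {U : Matrix m m ℂ} (hU : U ∈ unitaryGroup m ℂ) (f g : m → ℝ) :
    unitaryDiag U f * unitaryDiag U g = unitaryDiag U (fun i => f i * g i) := by
  have h := conjTranspose_mul_self_of_mem_unitary hU
  have hd : diagonal (fun i => ((f i * g i : ℝ) : ℂ)) =
      diagonal (fun i => (f i : ℂ)) * diagonal (fun i => (g i : ℂ)) := by
    rw [diagonal_mul_diagonal]; simp
  simp only [unitaryDiag, hd]
  calc _ = U * diagonal (fun i => (f i : ℂ)) * (Uᴴ * U) * diagonal (fun i => (g i : ℂ)) * Uᴴ := by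
        simp only [mul_assoc]
    _ = _ := by rw [h]; simp only [mul_assoc, mul_one]

theorem unitaryDiag_conjTranspose (U : Matrix m m ℂ) (f : m → ℝ) :
    (unitaryDiag U f)ᴴ = unitaryDiag U f := by
  simp [unitaryDiag, conjTranspose_mul, diagonal_conjTranspose, mul_assoc, Pi.star_def]

theorem unitaryDiag_one {U : Matrix m m ℂ} (hU : U ∈ unitaryGroup m ℂ) :
    unitaryDiag U (fun _ => 1) = 1 := by
  simp [unitaryDiag, self_mul_conjTranspose_of_mem_unitary hU]

theorem unitaryDiag_sub (U : Matrix m m ℂ) (f g : m → ℝ) :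
    unitaryDiag U f - unitaryDiag U g = unitaryDiag U (fun i => f i - g i) := by
  have hd : diagonal (fun i => ((f i - g i : ℝ) : ℂ)) =
      diagonal (fun i => (f i : ℂ)) - diagonal (fun i => (g i : ℂ)) := by
    rw [diagonal_sub]; simp
  simp only [unitaryDiag, hd, mul_sub, sub_mul]

theorem sum_unitaryDiag {ι : Type*} (s : Finset ι) (U : Matrix m m ℂ) (f : ι → m → ℝ) :
    ∑ k ∈ s, unitaryDiag U (f k) = unitaryDiag U (fun i => ∑ k ∈ s, f k i) := by
  have hd : diagonal (fun i => ((∑ k ∈ s, f k i : ℝ) : ℂ)) =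
      ∑ k ∈ s, diagonal (fun i => (f k i : ℂ)) := by
    ext i j
    rw [Matrix.sum_apply]
    by_cases h : i = j <;> simp [h]
  simp only [unitaryDiag, hd, Finset.mul_sum, Finset.sum_mul]

theorem unitaryDiag_smul (U : Matrix m m ℂ) (c : ℝ) (f : m → ℝ) :
    unitaryDiag U (fun i => c * f i) = (c : ℂ) • unitaryDiag U f := by
  have hd : diagonal (fun i => ((c * f i : ℝ) : ℂ)) = (c : ℂ) • diagonal (fun i => (f i : ℂ)) := by
    ext i j
    by_cases h : i = j <;> simp [h]
  simp only [unitaryDiag, hd, Matrix.mul_smul, Matrix.smul_mul]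

theorem trace_unitaryDiag {U : Matrix m m ℂ} (hU : U ∈ unitaryGroup m ℂ) (f : m → ℝ) :
    (unitaryDiag U f).trace = ((∑ i, f i : ℝ) : ℂ) := by
  rw [unitaryDiag, mul_assoc, trace_mul_comm, mul_assoc,
    conjTranspose_mul_self_of_mem_unitary hU, mul_one, trace_diagonal]
  simp

theorem posSemidef_unitaryDiag (U : Matrix m m ℂ) {f : m → ℝ} (hf : ∀ i, 0 ≤ f i) :
    (unitaryDiag U f).PosSemidef :=
  (PosSemidef.diagonal fun i => by simpa using hf i).mul_mul_conjTranspose_same U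

theorem exists_unitaryDiag_of_isHermitian {A : Matrix m m ℂ} (hA : A.IsHermitian) :
    A = unitaryDiag (hA.eigenvectorUnitary : Matrix m m ℂ) hA.eigenvalues := by
  conv_lhs => rw [hA.spectral_theorem]
  rfl

theorem exists_unitaryDiag_of_posSemidef {A : Matrix m m ℂ} (hA : A.PosSemidef) :
    ∃ U ∈ unitaryGroup m ℂ, ∃ f : m → ℝ, (∀ i, 0 ≤ f i) ∧ A = unitaryDiag U f :=
  ⟨_, hA.isHermitian.eigenvectorUnitary.2, _, hA.eigenvalues_nonneg,
    exists_unitaryDiag_of_isHermitian hA.isHermitian⟩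

theorem matFun_eq_unitaryDiag {A : Matrix m m ℂ} (hA : A.IsHermitian) (f : ℝ → ℝ) :
    matFun A f = unitaryDiag (hA.eigenvectorUnitary : Matrix m m ℂ)
      (fun i => f (hA.eigenvalues i)) := by
  rw [matFun, dif_pos hA]; rfl

theorem charpoly_unitaryDiag {U : Matrix m m ℂ} (hU : U ∈ unitaryGroup m ℂ) (f : m → ℝ) :
    (unitaryDiag U f).charpoly = (diagonal (fun i => (f i : ℂ))).charpoly := by
  rw [unitaryDiag, charpoly_mul_comm, ← mul_assoc, conjTranspose_mul_self_of_mem_unitary hU,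
    one_mul]

theorem roots_charpoly_unitaryDiag {U : Matrix m m ℂ} (hU : U ∈ unitaryGroup m ℂ) (f : m → ℝ) :
    (unitaryDiag U f).charpoly.roots = univ.val.map (fun i => (f i : ℂ)) := by
  rw [charpoly_unitaryDiag hU, charpoly_diagonal]
  simpa using Polynomial.roots_multiset_prod_X_sub_C (univ.val.map (fun i => (f i : ℂ)))

theorem sum_eq_of_charpoly_eq {U V : Matrix m m ℂ} (hU : U ∈ unitaryGroup m ℂ)
    (hV : V ∈ unitaryGroup m ℂ) {f g : m → ℝ}
    (h : (unitaryDiag U f).charpoly = (unitaryDiag V g).charpoly) (φ : ℝ → ℝ) :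
    ∑ i, φ (f i) = ∑ i, φ (g i) := by
  have h1 := roots_charpoly_unitaryDiag hU f
  rw [h, roots_charpoly_unitaryDiag hV] at h1
  have h2 := congrArg (fun s : Multiset ℂ => (s.map fun z => φ z.re).sum) h1
  simpa using h2.symm

theorem re_trace_diagonal_mul (X : Matrix m m ℂ) (a b : m → ℝ) :
    (diagonal (fun i => (a i : ℂ)) * X * diagonal (fun i => (b i : ℂ)) * Xᴴ).trace.re =
      ∑ i, ∑ j, a i * b j * Complex.normSq (X i j) := by
  simp only [trace, diag_apply, mul_apply (M := _ * diagonal _), mul_diagonal, diagonal_mul,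
    conjTranspose_apply, Complex.re_sum]
  refine sum_congr rfl fun i _ => sum_congr rfl fun j _ => ?_
  have : (a i : ℂ) * X i j * (b j : ℂ) * star (X i j) =
      ((a i * b j * Complex.normSq (X i j) : ℝ) : ℂ) := by
    push_cast
    rw [← Complex.mul_conj]
    simp only [RCLike.star_def]
    ring
  rw [this, Complex.ofReal_re]

theorem re_trace_unitaryDiag_mul_unitaryDiag (U V : Matrix m m ℂ) (a b : m → ℝ) :
    (unitaryDiag U a * unitaryDiag V b).trace.re =
      ∑ i, ∑ j, a i * b j * Complex.normSq ((Uᴴ * V) i j) := by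
  rw [← re_trace_diagonal_mul, unitaryDiag, unitaryDiag, conjTranspose_mul,
    conjTranspose_conjTranspose]
  congr 1
  calc _ = (U * (diagonal (fun i => (a i : ℂ)) * Uᴴ * (V * diagonal (fun i => (b i : ℂ)) * Vᴴ))
        ).trace := by simp only [mul_assoc]
    _ = _ := by rw [trace_mul_comm]; simp only [mul_assoc]

theorem sum_normSq_row {X : Matrix m m ℂ} (hX : X * Xᴴ = 1) (i : m) :
    ∑ j, Complex.normSq (X i j) = 1 := by
  have h := congrFun (congrFun hX i) i
  rw [mul_apply] at h
  simp only [conjTranspose_apply, RCLike.star_def, Complex.mul_conj, one_apply_eq] at h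
  exact_mod_cast h

theorem sum_normSq_col_eq {k : Type*} [Fintype k] (X : Matrix k k ℂ) (j : k) :
    ∑ i, Complex.normSq (X i j) = ((Xᴴ * X) j j).re := by
  rw [mul_apply]
  simp only [conjTranspose_apply, RCLike.star_def, Complex.re_sum]
  refine sum_congr rfl fun i _ => ?_
  rw [mul_comm, Complex.mul_conj, Complex.ofReal_re]

theorem sum_normSq_col {X : Matrix m m ℂ} (hX : Xᴴ * X = 1) (j : m) :
    ∑ i, Complex.normSq (X i j) = 1 := by
  rw [sum_normSq_col_eq, hX]; simp

theorem re_trace_mul_nonneg {A B : Matrix m m ℂ} (hA : A.PosSemidef) (hB : B.PosSemidef) :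
    0 ≤ (A * B).trace.re := by
  obtain ⟨U, -, a, ha, rfl⟩ := exists_unitaryDiag_of_posSemidef hA
  obtain ⟨V, -, b, hb, rfl⟩ := exists_unitaryDiag_of_posSemidef hB
  rw [re_trace_unitaryDiag_mul_unitaryDiag]
  exact sum_nonneg fun i _ => sum_nonneg fun j _ =>
    mul_nonneg (mul_nonneg (ha i) (hb j)) (Complex.normSq_nonneg _)

/-- Hölder's inequality for the trace of a product of two positive semidefinite matrices. -/
theorem re_trace_mul_le_holder {U V : Matrix m m ℂ} (hU : U ∈ unitaryGroup m ℂ)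
    (hV : V ∈ unitaryGroup m ℂ) {a b : m → ℝ} (ha : ∀ i, 0 ≤ a i) (hb : ∀ i, 0 ≤ b i)
    {p q : ℝ} (hpq : p.HolderConjugate q) :
    (unitaryDiag U a * unitaryDiag V b).trace.re ≤
      (∑ i, a i ^ p) ^ (1 / p) * (∑ i, b i ^ q) ^ (1 / q) := by
  rw [re_trace_unitaryDiag_mul_unitaryDiag]
  have hU1 := conjTranspose_mul_self_of_mem_unitary hU
  have hU2 := self_mul_conjTranspose_of_mem_unitary hU
  have hV1 := conjTranspose_mul_self_of_mem_unitary hV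
  have hV2 := self_mul_conjTranspose_of_mem_unitary hV
  set X := Uᴴ * V with hX
  have hX1 : X * Xᴴ = 1 := by
    rw [hX, conjTranspose_mul, conjTranspose_conjTranspose, mul_assoc, ← mul_assoc V, hV2, one_mul,
      hU1]
  have hX2 : Xᴴ * X = 1 := by
    rw [hX, conjTranspose_mul, conjTranspose_conjTranspose, mul_assoc, ← mul_assoc U, hU2, one_mul,
      hV1]
  set w : m → m → ℝ := fun i j => Complex.normSq (X i j) with hw
  have hw0 : ∀ i j, 0 ≤ w i j := fun i j => Complex.normSq_nonneg _
  have hp := hpq.pos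
  have hq := hpq.symm.pos
  have key := Real.inner_le_Lp_mul_Lq_of_nonneg (univ : Finset (m × m)) hpq
    (f := fun x => a x.1 * w x.1 x.2 ^ (1 / p)) (g := fun x => b x.2 * w x.1 x.2 ^ (1 / q))
    (fun x _ => mul_nonneg (ha _) (Real.rpow_nonneg (hw0 _ _) _))
    (fun x _ => mul_nonneg (hb _) (Real.rpow_nonneg (hw0 _ _) _))
  have e1 : ∀ x : m × m, a x.1 * w x.1 x.2 ^ (1 / p) * (b x.2 * w x.1 x.2 ^ (1 / q)) =
      a x.1 * b x.2 * w x.1 x.2 := by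
    intro x
    have : w x.1 x.2 ^ (1 / p) * w x.1 x.2 ^ (1 / q) = w x.1 x.2 := by
      rw [← Real.rpow_add_of_nonneg (hw0 _ _) (by positivity) (by positivity), one_div, one_div,
        hpq.inv_add_inv_eq_one, Real.rpow_one]
    linear_combination a x.1 * b x.2 * this
  have e2 : ∀ x : m × m, (a x.1 * w x.1 x.2 ^ (1 / p)) ^ p = a x.1 ^ p * w x.1 x.2 := by
    intro x
    rw [Real.mul_rpow (ha _) (Real.rpow_nonneg (hw0 _ _) _), ← Real.rpow_mul (hw0 _ _),
      one_div_mul_cancel hp.ne', Real.rpow_one]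
  have e3 : ∀ x : m × m, (b x.2 * w x.1 x.2 ^ (1 / q)) ^ q = b x.2 ^ q * w x.1 x.2 := by
    intro x
    rw [Real.mul_rpow (hb _) (Real.rpow_nonneg (hw0 _ _) _), ← Real.rpow_mul (hw0 _ _),
      one_div_mul_cancel hq.ne', Real.rpow_one]
  simp only [e1, e2, e3, Fintype.sum_prod_type] at key
  have e4 : ∑ i, ∑ j, a i ^ p * w i j = ∑ i, a i ^ p :=
    sum_congr rfl fun i _ => by rw [← mul_sum, hw, sum_normSq_row hX1, mul_one]
  have e5 : ∑ i, ∑ j, b j ^ q * w i j = ∑ j, b j ^ q := by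
    rw [sum_comm]
    exact sum_congr rfl fun i _ => by rw [← mul_sum, hw, sum_normSq_col hX2, mul_one]
  rwa [e4, e5] at key

theorem exists_hermitian_mul_self_eq {A : Matrix m m ℂ} (hA : A.PosSemidef) :
    ∃ K : Matrix m m ℂ, Kᴴ = K ∧ K * K = A := by
  obtain ⟨U, hU, f, hf, rfl⟩ := exists_unitaryDiag_of_posSemidef hA
  refine ⟨unitaryDiag U fun i => √(f i), unitaryDiag_conjTranspose _ _, ?_⟩
  rw [unitaryDiag_mul hU]
  simp only [Real.mul_self_sqrt (hf _)]

theorem sum_mul_rpow_le {ι : Type*} [Fintype ι] {w f : ι → ℝ} (hw : ∀ i, 0 ≤ w i)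
    (hw1 : ∑ i, w i ≤ 1)
    (hf : ∀ i, 0 ≤ f i) {κ : ℝ} (hκ : κ ∈ Set.Ioo (0 : ℝ) 1) :
    (∑ i, w i * f i ^ κ) ^ (1 / κ) ≤ ∑ i, w i * f i := by
  have hκ0 := hκ.1
  have hκ1 : 0 < 1 - κ := sub_pos.2 hκ.2
  have hpq : (1 / (1 - κ)).HolderConjugate (1 / κ) := by
    rw [Real.holderConjugate_iff]
    refine ⟨by rw [lt_div_iff₀ hκ1]; linarith, ?_⟩
    simp
  have hS : 0 ≤ ∑ i, w i * f i := sum_nonneg fun i _ => mul_nonneg (hw i) (hf i)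
  have key := Real.inner_le_Lp_mul_Lq_of_nonneg univ hpq
    (f := fun i => w i ^ (1 - κ)) (g := fun i => (w i * f i) ^ κ)
    (fun i _ => Real.rpow_nonneg (hw i) _)
    (fun i _ => Real.rpow_nonneg (mul_nonneg (hw i) (hf i)) _)
  have e1 : ∀ i, w i ^ (1 - κ) * (w i * f i) ^ κ = w i * f i ^ κ := by
    intro i
    rw [Real.mul_rpow (hw i) (hf i), ← mul_assoc,
      ← Real.rpow_add_of_nonneg (hw i) hκ1.le hκ0.le, sub_add_cancel, Real.rpow_one]
  have e2 : ∀ i, (w i ^ (1 - κ)) ^ (1 / (1 - κ)) = w i := by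
    intro i
    rw [← Real.rpow_mul (hw i), mul_one_div_cancel hκ1.ne', Real.rpow_one]
  have e3 : ∀ i, ((w i * f i) ^ κ) ^ (1 / κ) = w i * f i := by
    intro i
    rw [← Real.rpow_mul (mul_nonneg (hw i) (hf i)), mul_one_div_cancel hκ0.ne', Real.rpow_one]
  simp only [e1, e2, e3, one_div_one_div] at key
  have h1 : ∑ i, w i * f i ^ κ ≤ (∑ i, w i * f i) ^ κ :=
    key.trans (mul_le_of_le_one_left (Real.rpow_nonneg hS _)
      (Real.rpow_le_one (sum_nonneg fun i _ => hw i) hw1 hκ1.le))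
  calc _ ≤ ((∑ i, w i * f i) ^ κ) ^ (1 / κ) :=
        Real.rpow_le_rpow (sum_nonneg fun i _ => mul_nonneg (hw i) (Real.rpow_nonneg (hf i) _)) h1
          (by positivity)
    _ = _ := by rw [← Real.rpow_mul hS, mul_one_div_cancel hκ0.ne', Real.rpow_one]

/-- If `C = Y Yᴴ` with `Y = σ^{κ/2} K` and `K² = T` a test, then `Tr C^{1/κ} ≤ Tr σ T`. -/
theorem sum_rpow_le_re_trace_mul_test {U W : Matrix m m ℂ} (hU : U ∈ unitaryGroup m ℂ)
    (hW : W ∈ unitaryGroup m ℂ) {l c : m → ℝ} (hl : ∀ i, 0 ≤ l i) {T : Matrix m m ℂ}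
    (hT : IsTest T) {κ : ℝ} (hκ : κ ∈ Set.Ioo (0 : ℝ) 1)
    (hC : unitaryDiag U (fun i => l i ^ (κ / 2)) * T * unitaryDiag U (fun i => l i ^ (κ / 2)) =
      unitaryDiag W c) :
    ∑ i, c i ^ (1 / κ) ≤ (unitaryDiag U l * T).trace.re := by
  obtain ⟨K, hK, rfl⟩ := exists_hermitian_mul_self_eq hT.1
  set S := unitaryDiag U (fun i => l i ^ (κ / 2)) with hS
  have hSS : S * S = unitaryDiag U (fun i => l i ^ κ) := by
    rw [hS, unitaryDiag_mul hU]
    congr 1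
    ext i
    rw [← Real.rpow_add_of_nonneg (hl i) (by linarith [hκ.1]) (by linarith [hκ.1]), add_halves]
  have hG : (K * unitaryDiag U (fun i => l i ^ κ) * K).PosSemidef := by
    have := (posSemidef_unitaryDiag U (f := fun i => l i ^ κ)
      fun i => Real.rpow_nonneg (hl i) _).mul_mul_conjTranspose_same K
    rwa [hK] at this
  obtain ⟨Z, hZ, g, hg, hGZ⟩ := exists_unitaryDiag_of_posSemidef hG
  have hch : (unitaryDiag W c).charpoly = (unitaryDiag Z g).charpoly := by
    rw [← hC, ← hGZ, ← hSS]
    have e1 : S * (K * K) * S = (S * K) * (K * S) := by simp only [mul_assoc]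
    have e2 : K * (S * S) * K = (K * S) * (S * K) := by simp only [mul_assoc]
    rw [e1, e2, charpoly_mul_comm]
  rw [sum_eq_of_charpoly_eq hW hZ hch (fun x => x ^ (1 / κ))]
  have hZ1 := conjTranspose_mul_self_of_mem_unitary hZ
  have hZ2 := self_mul_conjTranspose_of_mem_unitary hZ
  have hU2 := self_mul_conjTranspose_of_mem_unitary hU
  set X := Uᴴ * K * Z with hX
  have hXh : Xᴴ = Zᴴ * K * U := by
    simp only [hX, conjTranspose_mul, conjTranspose_conjTranspose, hK, mul_assoc]
  have hXX : Xᴴ * X = Zᴴ * (K * K) * Z := by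
    rw [hXh, hX]
    calc _ = Zᴴ * K * (U * Uᴴ) * K * Z := by simp only [mul_assoc]
      _ = _ := by rw [hU2, mul_one]; simp only [mul_assoc]
  have hw1 : ∀ j, ∑ i, Complex.normSq (X i j) ≤ 1 := by
    intro j
    rw [sum_normSq_col_eq, hXX]
    have h1 := (hT.2.conjTranspose_mul_mul_same Z).diag_nonneg (i := j)
    rw [mul_sub, sub_mul, mul_one, hZ1, Matrix.sub_apply, one_apply_eq] at h1
    have := (Complex.le_def.1 h1).1
    simp only [Complex.zero_re, Complex.sub_re, Complex.one_re] at this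
    linarith
  have hdiag : ∀ (f : m → ℝ) (j : m), ((Zᴴ * (K * unitaryDiag U f * K) * Z) j j).re =
      ∑ i, Complex.normSq (X i j) * f i := by
    intro f j
    have e : Zᴴ * (K * unitaryDiag U f * K) * Z = Xᴴ * (diagonal (fun i => (f i : ℂ)) * X) := by
      rw [hXh, hX, unitaryDiag]
      simp only [mul_assoc]
    rw [e, mul_apply, Complex.re_sum]
    refine sum_congr rfl fun i _ => ?_
    have : Xᴴ j i * (diagonal (fun i => (f i : ℂ)) * X) i j =
        ((Complex.normSq (X i j) * f i : ℝ) : ℂ) := by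
      rw [diagonal_mul, conjTranspose_apply, Complex.ofReal_mul, ← Complex.mul_conj]
      simp only [RCLike.star_def]
      ring
    rw [this, Complex.ofReal_re]
  have hgj : ∀ j, g j = ∑ i, Complex.normSq (X i j) * l i ^ κ := by
    intro j
    rw [← hdiag, hGZ, unitaryDiag]
    have : Zᴴ * (Z * diagonal (fun i => (g i : ℂ)) * Zᴴ) * Z =
        (Zᴴ * Z) * diagonal (fun i => (g i : ℂ)) * (Zᴴ * Z) := by simp only [mul_assoc]
    rw [this, hZ1, one_mul, mul_one, diagonal_apply_eq, Complex.ofReal_re]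
  calc ∑ j, g j ^ (1 / κ) ≤ ∑ j, ∑ i, Complex.normSq (X i j) * l i := by
        refine sum_le_sum fun j _ => ?_
        rw [hgj]
        exact sum_mul_rpow_le (fun i => Complex.normSq_nonneg _) (hw1 j) hl hκ
    _ = ∑ j, ((Zᴴ * (K * unitaryDiag U l * K) * Z) j j).re := by simp only [hdiag]
    _ = (Zᴴ * (K * unitaryDiag U l * K) * Z).trace.re := by
        simp only [trace, diag_apply, Complex.re_sum]
    _ = _ := by
        rw [trace_mul_comm, ← mul_assoc, hZ2, one_mul, mul_assoc, trace_mul_comm, mul_assoc]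

/-- Monotonicity of the sandwiched Rényi quantity under a binary test, written for
`ρ = σ^{κ/2} A σ^{κ/2}`. -/
theorem re_trace_mul_test_le {U V : Matrix m m ℂ} (hU : U ∈ unitaryGroup m ℂ)
    (hV : V ∈ unitaryGroup m ℂ) {l a : m → ℝ} (hl : ∀ i, 0 ≤ l i) (ha : ∀ i, 0 ≤ a i)
    {T : Matrix m m ℂ} (hT : IsTest T) {κ : ℝ} (hκ : κ ∈ Set.Ioo (0 : ℝ) 1) :
    (unitaryDiag U (fun i => l i ^ (κ / 2)) * unitaryDiag V a *
      unitaryDiag U (fun i => l i ^ (κ / 2)) * T).trace.re ≤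
      (∑ i, a i ^ (1 / (1 - κ))) ^ (1 - κ) * (unitaryDiag U l * T).trace.re ^ κ := by
  set S := unitaryDiag U (fun i => l i ^ (κ / 2)) with hS
  have hSh : Sᴴ = S := unitaryDiag_conjTranspose _ _
  have hκ1 : 0 < 1 - κ := sub_pos.2 hκ.2
  have hpq : (1 / (1 - κ)).HolderConjugate (1 / κ) := by
    rw [Real.holderConjugate_iff]
    refine ⟨by rw [lt_div_iff₀ hκ1]; linarith [hκ.1], ?_⟩
    simp
  have hC : (S * T * S).PosSemidef := by
    have := hT.1.mul_mul_conjTranspose_same S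
    rwa [hSh] at this
  obtain ⟨W, hW, c, hc, hCW⟩ := exists_unitaryDiag_of_posSemidef hC
  have e : (S * unitaryDiag V a * S * T).trace = (unitaryDiag V a * unitaryDiag W c).trace := by
    rw [← hCW, mul_assoc, mul_assoc, trace_mul_comm]
    simp only [mul_assoc]
  rw [e]
  refine (re_trace_mul_le_holder hV hW ha hc hpq).trans ?_
  rw [one_div_one_div, one_div_one_div]
  refine mul_le_mul_of_nonneg_left ?_ (Real.rpow_nonneg (sum_nonneg fun i _ =>
    Real.rpow_nonneg (ha i) _) _)
  exact Real.rpow_le_rpow (sum_nonneg fun i _ => Real.rpow_nonneg (hc i) _)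
    (sum_rpow_le_re_trace_mul_test hU hW hl hT hκ hCW) hκ.1.le

theorem re_trace_conjTranspose_mul_self {k : Type*} [Fintype k] (X : Matrix k k ℂ) :
    (Xᴴ * X).trace.re = ∑ j, ∑ i, Complex.normSq (X i j) := by
  simp only [sum_normSq_col_eq, trace, diag_apply, Complex.re_sum]

theorem normSq_sum_le {τ : Type*} [Fintype τ] (z : τ → ℂ) :
    Complex.normSq (∑ k, z k) ≤ Fintype.card τ * ∑ k, Complex.normSq (z k) := by
  simp only [Complex.normSq_eq_norm_sq]
  calc _ ≤ (∑ k, ‖z k‖) ^ 2 := by gcongr; exact norm_sum_le _ _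
    _ ≤ _ := sq_sum_le_card_mul_sum_sq

/-- The pinching inequality, tested against a positive semidefinite matrix. -/
theorem re_trace_mul_le_pinching {τ : Type*} [Fintype τ] [DecidableEq τ] {U : Matrix m m ℂ}
    (hU : U ∈ unitaryGroup m ℂ) (t : m → τ) {A M : Matrix m m ℂ} (hA : A.PosSemidef)
    (hM : M.PosSemidef) :
    (A * M).trace.re ≤ Fintype.card τ * ∑ k,
      (unitaryDiag U (fun i => if t i = k then 1 else 0) * A *
        unitaryDiag U (fun i => if t i = k then 1 else 0) * M).trace.re := by
  obtain ⟨L, hL, rfl⟩ := exists_hermitian_mul_self_eq hA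
  obtain ⟨N, hN, rfl⟩ := exists_hermitian_mul_self_eq hM
  set E : τ → Matrix m m ℂ := fun k => unitaryDiag U (fun i => if t i = k then 1 else 0) with hE
  have hE1 : ∑ k, E k = 1 := by
    rw [hE, sum_unitaryDiag, ← unitaryDiag_one hU]
    congr 1
    ext i
    simp
  have hEh : ∀ k, (E k)ᴴ = E k := fun k => unitaryDiag_conjTranspose _ _
  have e1 : (L * L * (N * N)).trace.re = ∑ j, ∑ i, Complex.normSq (∑ k, (L * E k * N) i j) := by
    have : L * N = ∑ k, L * E k * N := by
      rw [← Finset.sum_mul, ← Finset.mul_sum, hE1, mul_one]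
    simp only [← Matrix.sum_apply]
    rw [← this, ← re_trace_conjTranspose_mul_self, conjTranspose_mul, hL, hN, ← mul_assoc,
      trace_mul_comm]
    simp only [mul_assoc]
  have e2 : ∀ k, (E k * (L * L) * E k * (N * N)).trace.re =
      ∑ j, ∑ i, Complex.normSq ((L * E k * N) i j) := by
    intro k
    rw [← re_trace_conjTranspose_mul_self, conjTranspose_mul, conjTranspose_mul, hL, hN, hEh,
      ← mul_assoc, trace_mul_comm]
    simp only [mul_assoc]
  rw [e1, sum_congr rfl fun k _ => e2 k]
  calc _ ≤ ∑ j, ∑ i, Fintype.card τ * ∑ k, Complex.normSq ((L * E k * N) i j) :=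
        sum_le_sum fun j _ => sum_le_sum fun i _ => normSq_sum_le _
    _ = _ := by
        simp only [← mul_sum]
        congr 1
        rw [sum_comm (s := univ (α := τ))]
        exact sum_congr rfl fun j _ => sum_comm

theorem sum_le_harmonic_mul {ι : Type*} {f : ι → ℝ} (hf : ∀ i, 0 ≤ f i) {W : ℝ} (s : Finset ι)
    (h : ∀ i ∈ s, f i * #{j ∈ s | f i ≤ f j} ≤ W) :
    ∑ i ∈ s, f i ≤ (harmonic #s : ℝ) * W := by
  classical
  revert h
  refine Finset.induction_on_min_value f s (by simp) fun a s ha hmin ih h => ?_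
  have h0 : ∀ i ∈ s, f i * #{j ∈ s | f i ≤ f j} ≤ W := fun i hi =>
    (mul_le_mul_of_nonneg_left (by
      exact_mod_cast card_le_card (filter_subset_filter _ (subset_insert _ _))) (hf i)).trans
      (h i (mem_insert_of_mem hi))
  rw [sum_insert ha, card_insert_of_notMem ha, harmonic_succ]
  have h1 := h a (mem_insert_self _ _)
  have h2 : ({j ∈ insert a s | f a ≤ f j} : Finset ι) = insert a s := by
    apply filter_true_of_mem
    intro j hj
    rcases mem_insert.1 hj with rfl | hj
    · exact le_rfl
    · exact hmin j hj
  rw [h2, card_insert_of_notMem ha] at h1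
  have h3 : f a ≤ ((#s + 1 : ℕ) : ℝ)⁻¹ * W := by
    rw [inv_mul_eq_div, le_div_iff₀ (by positivity)]
    exact h1
  push_cast at h3 ⊢
  linarith [ih h0]

/-- Some superlevel set carries, up to a harmonic factor, the whole sum of a nonnegative
family. -/
theorem exists_superlevel {ι : Type*} [Fintype ι] {f : ι → ℝ} (hf : ∀ i, 0 ≤ f i)
    (h : 0 < ∑ i, f i) :
    ∃ i, 0 < f i ∧ ∑ i, f i ≤ harmonic (Fintype.card ι) * (f i * #{j | f i ≤ f j}) := by
  have hne : Nonempty ι := by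
    by_contra hne
    rw [not_nonempty_iff] at hne
    simp at h
  obtain ⟨i, -, hi⟩ := exists_max_image univ (fun i => f i * (#{j | f i ≤ f j} : ℝ))
    univ_nonempty
  have hs := sum_le_harmonic_mul hf univ hi
  rw [card_univ] at hs
  refine ⟨i, (hf i).lt_of_ne fun h0 => ?_, hs⟩
  rw [← h0] at hs
  simp at hs
  linarith

theorem exists_test_of_pinching {τ : Type*} [Fintype τ] [DecidableEq τ] {U V : Matrix m m ℂ}
    (hU : U ∈ unitaryGroup m ℂ) (hV : V ∈ unitaryGroup m ℂ) {l a : m → ℝ} (hl : ∀ i, 0 ≤ l i)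
    (ha : ∀ i, 0 ≤ a i) (t : m → τ) (ht : ∀ i j, t i = t j → l i = l j)
    (hsupp : unitaryDiag V a * unitaryDiag U (fun i => if l i = 0 then 0 else 1) = unitaryDiag V a)
    {κ : ℝ} (hκ : κ ∈ Set.Ioo (0 : ℝ) 1) (hpos : 0 < ∑ i, a i ^ (1 / (1 - κ))) :
    ∃ T : Matrix m m ℂ, IsTest T ∧ ∃ P R : ℝ,
      P = (unitaryDiag U (fun i => l i ^ (κ / 2)) * unitaryDiag V a *
        unitaryDiag U (fun i => l i ^ (κ / 2)) * T).trace.re ∧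
      R = (unitaryDiag U l * T).trace.re ∧ (∃ i, 0 < l i ∧ l i ≤ R) ∧ 0 < P ∧
      (∑ i, a i ^ (1 / (1 - κ))) ^ (1 - κ) ≤ (Fintype.card τ : ℝ) ^ 2 *
        (harmonic (Fintype.card m) : ℝ) ^ (1 - κ) * (P * R ^ (-κ)) := by
  have hκ0 := hκ.1
  have hκ1 : 0 < 1 - κ := sub_pos.2 hκ.2
  have hpq : (1 / (1 - κ)).HolderConjugate (1 / κ) := by
    rw [Real.holderConjugate_iff]
    refine ⟨by rw [lt_div_iff₀ hκ1]; linarith, ?_⟩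
    simp
  set α := 1 / (1 - κ) with hα
  have hα1 : 1 < α := hpq.lt
  have hα0 : 0 < α := hpq.pos
  have hακ : (α - 1) * (1 / κ) = α := by rw [hα]; field_simp; ring
  set Q := ∑ i, a i ^ α with hQ
  set A := unitaryDiag V a with hA
  set S := unitaryDiag U (fun i => l i ^ (κ / 2)) with hS
  set E : τ → Matrix m m ℂ := fun k => unitaryDiag U (fun i => if t i = k then 1 else 0) with hE
  set M := unitaryDiag V (fun i => a i ^ (α - 1)) with hM
  have hAM : (A * M).trace.re = Q := by
    rw [hA, hM, unitaryDiag_mul hV, trace_unitaryDiag hV, Complex.ofReal_re]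
    refine sum_congr rfl fun i _ => ?_
    conv_lhs => rw [← Real.rpow_one (a i), ← Real.rpow_mul (ha i), one_mul]
    rw [← Real.rpow_add_of_nonneg (ha i) zero_le_one (by linarith), add_sub_cancel]
  have hApsd : A.PosSemidef := posSemidef_unitaryDiag V ha
  have hpin := re_trace_mul_le_pinching hU t hApsd
    (posSemidef_unitaryDiag V (f := fun i => a i ^ (α - 1)) fun i => Real.rpow_nonneg (ha i) _)
  rw [hAM] at hpin
  have hτ : Nonempty τ := by
    by_contra hne
    rw [not_nonempty_iff] at hne
    simp at hpin
    linarith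
  have hv : (0 : ℝ) < Fintype.card τ := by exact_mod_cast Fintype.card_pos
  obtain ⟨k, -, hk⟩ := exists_max_image univ (fun k => (E k * A * E k * M).trace.re) univ_nonempty
  have hk1 : Q ≤ (Fintype.card τ : ℝ) ^ 2 * (E k * A * E k * M).trace.re := by
    refine hpin.trans ?_
    rw [sq, mul_assoc]
    refine mul_le_mul_of_nonneg_left ?_ hv.le
    refine (sum_le_sum hk).trans ?_
    rw [sum_const, card_univ, nsmul_eq_mul]
  have hEh : (E k)ᴴ = E k := unitaryDiag_conjTranspose _ _
  have hB : (E k * A * E k).PosSemidef := by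
    have := hApsd.mul_mul_conjTranspose_same (E k)
    rwa [hEh] at this
  obtain ⟨Z, hZ, b, hb, hBZ⟩ := exists_unitaryDiag_of_posSemidef hB
  have hholder : (E k * A * E k * M).trace.re ≤ (∑ i, b i ^ α) ^ (1 - κ) * Q ^ κ := by
    have := re_trace_mul_le_holder hZ hV hb (b := fun i => a i ^ (α - 1))
      (fun i => Real.rpow_nonneg (ha i) _) hpq
    rw [← hBZ] at this
    simp only [← Real.rpow_mul (ha _), hακ, one_div_one_div] at this
    simpa only [hα, one_div_one_div] using this
  have hQb : Q ^ (1 - κ) ≤ (Fintype.card τ : ℝ) ^ 2 * (∑ i, b i ^ α) ^ (1 - κ) := by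
    have h1 : Q ^ (1 - κ) * Q ^ κ ≤
        (Fintype.card τ : ℝ) ^ 2 * (∑ i, b i ^ α) ^ (1 - κ) * Q ^ κ := by
      rw [← Real.rpow_add hpos, sub_add_cancel, Real.rpow_one, mul_assoc]
      exact hk1.trans (mul_le_mul_of_nonneg_left hholder (by positivity))
    exact le_of_mul_le_mul_right h1 (Real.rpow_pos_of_pos hpos _)
  have hbpos : 0 < ∑ i, b i ^ α := by
    refine (sum_nonneg fun i _ => Real.rpow_nonneg (hb i) _).lt_of_ne fun h0 => ?_
    rw [← h0, Real.zero_rpow hκ1.ne', mul_zero] at hQb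
    exact (Real.rpow_pos_of_pos hpos _).not_ge hQb
  obtain ⟨i₀, hi₀, hle⟩ := exists_superlevel (fun i => Real.rpow_nonneg (hb i) α) hbpos
  set c : ℝ := (#{j | b i₀ ^ α ≤ b j ^ α} : ℝ) with hc
  have hb₀ : 0 < b i₀ := by
    refine (hb i₀).lt_of_ne fun h0 => ?_
    rw [← h0, Real.zero_rpow hα0.ne'] at hi₀
    exact lt_irrefl _ hi₀
  have hc1 : 1 ≤ c := by
    have : 0 < #{j | b i₀ ^ α ≤ b j ^ α} := card_pos.2 ⟨i₀, by simp⟩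
    rw [hc]
    exact_mod_cast this
  have hc0 : 0 < c := by linarith
  set χ : m → ℝ := fun j => if b i₀ ^ α ≤ b j ^ α then 1 else 0 with hχ
  have hχ0 : ∀ j, 0 ≤ χ j := fun j => by rw [hχ]; dsimp only; split_ifs <;> norm_num
  have hχ1 : ∀ j, χ j ≤ 1 := fun j => by rw [hχ]; dsimp only; split_ifs <;> norm_num
  have hχsum : ∑ j, χ j = c := by simp [hχ, hc]
  have hχb : ∀ j, b i₀ * χ j ≤ b j * χ j := by
    intro j
    by_cases h : b i₀ ^ α ≤ b j ^ α
    · exact mul_le_mul_of_nonneg_right ((Real.rpow_le_rpow_iff (hb _) (hb _) hα0).1 h) (hχ0 j)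
    · simp [hχ, h]
  have hEE : E k * E k = E k := by
    rw [hE, unitaryDiag_mul hU]
    congr 1
    ext i
    split_ifs <;> simp
  obtain ⟨i₁, hi₁, hl₁⟩ : ∃ i, t i = k ∧ l i ≠ 0 := by
    by_contra! hcon
    have h1 : unitaryDiag U (fun i => if l i = 0 then 0 else 1) * E k = 0 := by
      rw [hE, unitaryDiag_mul hU]
      have : (fun i => (if l i = 0 then (0 : ℝ) else 1) * (if t i = k then 1 else 0)) =
          fun _ => 0 := by
        ext i
        by_cases hi : t i = k
        · simp [hcon i hi]
        · simp [hi]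
      rw [this]
      simp [unitaryDiag]
    have h2 : E k * A * E k = 0 := by
      rw [← hsupp, mul_assoc, mul_assoc, h1, mul_zero, mul_zero]
    have h3 := trace_unitaryDiag hZ b
    rw [← hBZ, h2, trace_zero] at h3
    have h4 : ∑ i, b i = 0 := by exact_mod_cast h3.symm
    have h5 := (sum_eq_zero_iff_of_nonneg fun i _ => hb i).1 h4 i₀ (mem_univ _)
    linarith
  set q := l i₁ with hq
  have hq0 : 0 < q := (hl i₁).lt_of_ne hl₁.symm
  have hlE : ∀ f : ℝ → ℝ, unitaryDiag U (fun i => f (l i)) * E k = (f q : ℂ) • E k := by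
    intro f
    rw [hE, unitaryDiag_mul hU, ← unitaryDiag_smul]
    congr 1
    ext i
    by_cases hi : t i = k
    · rw [ht i i₁ (hi.trans hi₁.symm)]
    · simp [hi]
  have hEl : ∀ f : ℝ → ℝ, E k * unitaryDiag U (fun i => f (l i)) = (f q : ℂ) • E k := by
    intro f
    rw [← hlE, hE, unitaryDiag_mul hU, unitaryDiag_mul hU]
    simp only [mul_comm]
  set T := unitaryDiag Z χ with hT
  have hTh : Tᴴ = T := unitaryDiag_conjTranspose _ _
  have hET : E k * T = T := by
    have h1 : (E k * A * E k) * unitaryDiag Z (fun j => χ j / b j) = T := by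
      rw [hBZ, unitaryDiag_mul hZ]
      congr 1
      ext j
      by_cases h : b i₀ ^ α ≤ b j ^ α
      · have : b j ≠ 0 :=
          (hb₀.trans_le ((Real.rpow_le_rpow_iff (hb _) (hb _) hα0).1 h)).ne'
        field_simp
      · simp [hχ, h]
    rw [← h1]
    simp only [← mul_assoc, hEE]
  have hTE : T * E k = T := by
    have := congrArg conjTranspose hET
    rwa [conjTranspose_mul, hEh, hTh] at this
  have hR : (unitaryDiag U l * T).trace.re = q * c := by
    have h1 := hlE id
    simp only [id] at h1
    rw [← hET, ← mul_assoc, h1, Matrix.smul_mul, hET, trace_smul, trace_unitaryDiag hZ, hχsum,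
      smul_eq_mul, ← Complex.ofReal_mul, Complex.ofReal_re]
  have hP : (S * A * S * T).trace.re = q ^ κ * ∑ j, b j * χ j := by
    have h1 := hlE fun x => x ^ (κ / 2)
    have h2 := hEl fun x => x ^ (κ / 2)
    have e1 : S * A * S * T = S * A * (S * E k) * T * E k := by
      have : S * A * (S * E k) * T * E k = S * A * S * (E k * T * E k) := by
        simp only [mul_assoc]
      rw [this, hET, hTE]
    have e2 : E k * (S * A * (S * E k) * T) = (E k * S) * A * (S * E k) * T := by
      simp only [mul_assoc]
    rw [e1, trace_mul_comm, e2, h1, h2]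
    simp only [Matrix.smul_mul, Matrix.mul_smul, trace_smul, smul_eq_mul]
    rw [hBZ, unitaryDiag_mul hZ, trace_unitaryDiag hZ, ← mul_assoc, ← Complex.ofReal_mul,
      ← Complex.ofReal_mul, Complex.ofReal_re, ← Real.rpow_add hq0, add_halves]
  have hp : b i₀ * c ≤ ∑ j, b j * χ j := by
    rw [← hχsum, mul_sum]
    exact sum_le_sum fun j _ => hχb j
  have hp0 : 0 < ∑ j, b j * χ j := (mul_pos hb₀ hc0).trans_le hp
  refine ⟨T, ⟨posSemidef_unitaryDiag Z hχ0, ?_⟩, _, _, rfl, rfl, ⟨i₁, hq0, ?_⟩, ?_, ?_⟩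
  · rw [← unitaryDiag_one hZ, unitaryDiag_sub]
    exact posSemidef_unitaryDiag Z fun j => sub_nonneg.2 (hχ1 j)
  · rw [hR]
    exact le_mul_of_one_le_right hq0.le hc1
  · rw [hP]
    exact mul_pos (Real.rpow_pos_of_pos hq0 _) hp0
  · have h1 : (∑ i, b i ^ α) ^ (1 - κ) ≤
        (harmonic (Fintype.card m) : ℝ) ^ (1 - κ) * (b i₀ * c ^ (1 - κ)) := by
      have hH : (0 : ℝ) ≤ harmonic (Fintype.card m) := by
        have : (0 : ℚ) ≤ harmonic (Fintype.card m) := sum_nonneg fun i _ => by positivity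
        exact_mod_cast this
      refine (Real.rpow_le_rpow hbpos.le hle hκ1.le).trans_eq ?_
      rw [Real.mul_rpow hH (mul_nonneg hi₀.le hc0.le), Real.mul_rpow hi₀.le hc0.le,
        ← Real.rpow_mul (hb i₀), hα, one_div_mul_cancel hκ1.ne', Real.rpow_one]
    have h2 : b i₀ * c ^ (1 - κ) ≤ (S * A * S * T).trace.re *
        (unitaryDiag U l * T).trace.re ^ (-κ) := by
      have e : c ^ (1 - κ) = c * c ^ (-κ) := by
        rw [sub_eq_add_neg, Real.rpow_add hc0, Real.rpow_one]
      have e' : q ^ κ * q ^ (-κ) = 1 := by rw [← Real.rpow_add hq0, add_neg_cancel, Real.rpow_zero]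
      rw [hP, hR, Real.mul_rpow hq0.le hc0.le, e]
      have h3 := mul_le_mul_of_nonneg_right hp (Real.rpow_nonneg hc0.le (-κ))
      calc _ = b i₀ * c * c ^ (-κ) := by ring
        _ ≤ _ := h3
        _ = (q ^ κ * q ^ (-κ)) * ((∑ j, b j * χ j) * c ^ (-κ)) := by rw [e', one_mul]
        _ = _ := by ring
    rw [mul_assoc]
    refine hQb.trans (mul_le_mul_of_nonneg_left (h1.trans ?_) (by positivity))
    refine mul_le_mul_of_nonneg_left h2 ?_
    apply Real.rpow_nonneg
    have : (0 : ℚ) ≤ harmonic (Fintype.card m) := sum_nonneg fun i _ => by positivity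
    exact_mod_cast this

end Spectral

section TensorPow

variable {d : ℕ}

theorem tensorPow_mul (A B : Matrix (Fin d) (Fin d) ℂ) (N : ℕ) :
    tensorPow (A * B) N = tensorPow A N * tensorPow B N := by
  ext x y
  simp only [tensorPow, of_apply, mul_apply, ← prod_mul_distrib]
  exact Fintype.prod_sum fun i j => A (x i) j * B j (y i)

theorem tensorPow_conjTranspose (A : Matrix (Fin d) (Fin d) ℂ) (N : ℕ) :
    tensorPow Aᴴ N = (tensorPow A N)ᴴ := by
  ext x y
  simp [tensorPow]

theorem tensorPow_diagonal (f : Fin d → ℝ) (N : ℕ) :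
    tensorPow (diagonal fun i => (f i : ℂ)) N = diagonal fun x => ((∏ i, f (x i) : ℝ) : ℂ) := by
  ext x y
  simp only [tensorPow, of_apply]
  by_cases h : x = y
  · subst h
    simp
  · rw [diagonal_apply_ne _ h]
    obtain ⟨i, hi⟩ := Function.ne_iff.1 h
    exact prod_eq_zero (mem_univ i) (diagonal_apply_ne _ hi)

theorem tensorPow_one (N : ℕ) : tensorPow (1 : Matrix (Fin d) (Fin d) ℂ) N = 1 := by
  have := tensorPow_diagonal (fun _ : Fin d => 1) N
  simpa using this

theorem tensorPow_mem_unitary {U : Matrix (Fin d) (Fin d) ℂ} (hU : U ∈ unitaryGroup (Fin d) ℂ)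
    (N : ℕ) : tensorPow U N ∈ unitaryGroup (Fin N → Fin d) ℂ := by
  rw [mem_unitaryGroup_iff, star_eq_conjTranspose, ← tensorPow_conjTranspose, ← tensorPow_mul,
    self_mul_conjTranspose_of_mem_unitary hU, tensorPow_one]

theorem tensorPow_unitaryDiag (U : Matrix (Fin d) (Fin d) ℂ) (f : Fin d → ℝ) (N : ℕ) :
    tensorPow (unitaryDiag U f) N = unitaryDiag (tensorPow U N) fun x => ∏ i, f (x i) := by
  rw [unitaryDiag, tensorPow_mul, tensorPow_mul, tensorPow_diagonal, tensorPow_conjTranspose,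
    unitaryDiag]

theorem sum_prod_rpow {a : Fin d → ℝ} (ha : ∀ i, 0 ≤ a i) (α : ℝ) (N : ℕ) :
    ∑ x : Fin N → Fin d, (∏ i, a (x i)) ^ α = (∑ i, a i ^ α) ^ N := by
  rw [Fintype.sum_pow]
  exact sum_congr rfl fun x _ => (Real.finsetProd_rpow _ _ (fun i _ => ha _) _).symm

theorem suppLE.mul_eq {ρ σ E : Matrix (Fin d) (Fin d) ℂ} (h : suppLE ρ σ) (hE : σ * E = σ) :
    ρ * E = ρ := by
  have h0 : ρ * (1 - E) = 0 := by
    refine ext_of_mulVec_single fun i => ?_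
    have h1 : (1 - E) *ᵥ Pi.single i 1 ∈ LinearMap.ker σ.mulVecLin := by
      rw [LinearMap.mem_ker, mulVecLin_apply, mulVec_mulVec, mul_sub, mul_one, hE, sub_self,
        zero_mulVec]
    have h2 := h h1
    rw [LinearMap.mem_ker, mulVecLin_apply, mulVec_mulVec] at h2
    rw [h2, zero_mulVec]
  rw [mul_sub, mul_one, sub_eq_zero] at h0
  exact h0.symm

/-- Spectral data of the pair `(ρ, σ)`: with `A = σ^{-κ/2} ρ σ^{-κ/2}`, one has
`ρ = σ^{κ/2} A σ^{κ/2}` and `Q*_{1/(1-κ)}(ρ‖σ) = Tr A^{1/(1-κ)}`. -/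
theorem exists_spectral_data {ρ σ : Matrix (Fin d) (Fin d) ℂ} (hρ : IsDensityMatrix ρ)
    (hσ : IsDensityMatrix σ) (hsupp : suppLE ρ σ) {κ : ℝ} (hκ : κ ∈ Set.Ioo (0 : ℝ) 1) :
    ∃ U ∈ unitaryGroup (Fin d) ℂ, ∃ V ∈ unitaryGroup (Fin d) ℂ, ∃ l a : Fin d → ℝ,
      (∀ i, 0 ≤ l i) ∧ (∀ i, 0 ≤ a i) ∧ σ = unitaryDiag U l ∧
      ρ = unitaryDiag U (fun i => l i ^ (κ / 2)) * unitaryDiag V a *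
        unitaryDiag U (fun i => l i ^ (κ / 2)) ∧
      unitaryDiag V a * unitaryDiag U (fun i => if l i = 0 then 0 else 1) = unitaryDiag V a ∧
      0 < ∑ i, a i ^ (1 / (1 - κ)) ∧
      Qstar (1 / (1 - κ)) ρ σ = ENNReal.ofReal (∑ i, a i ^ (1 / (1 - κ))) := by
  have hκ1 : 0 < 1 - κ := sub_pos.2 hκ.2
  have hα0 : 0 < 1 / (1 - κ) := by positivity
  have hexp : (1 - 1 / (1 - κ)) / (2 * (1 / (1 - κ))) = -(κ / 2) := by field_simp; ring
  have hl := hσ.1.eigenvalues_nonneg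
  set l := hσ.1.isHermitian.eigenvalues with hl_def
  have hU := hσ.1.isHermitian.eigenvectorUnitary.2
  set U := (hσ.1.isHermitian.eigenvectorUnitary : Matrix (Fin d) (Fin d) ℂ) with hU_def
  have hσU : σ = unitaryDiag U l := exists_unitaryDiag_of_isHermitian _
  set S' := unitaryDiag U (fun i => if l i = 0 then 0 else l i ^ (-(κ / 2))) with hS'
  set S := unitaryDiag U (fun i => l i ^ (κ / 2)) with hS
  set I := unitaryDiag U (fun i => if l i = 0 then 0 else 1) with hI
  have hpow : matPow σ ((1 - 1 / (1 - κ)) / (2 * (1 / (1 - κ)))) = S' := by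
    rw [hexp, matPow, matFun_eq_unitaryDiag hσ.1.isHermitian]
  have hSS' : S * S' = I := by
    rw [hS, hS', unitaryDiag_mul hU]
    congr 1
    ext i
    split_ifs with h
    · simp
    · rw [← Real.rpow_add ((hl i).lt_of_ne' h), add_neg_cancel, Real.rpow_zero]
  have hS'S : S' * S = I := by
    rw [← hSS', hS, hS', unitaryDiag_mul hU, unitaryDiag_mul hU]
    simp only [mul_comm]
  have hS'I : S' * I = S' := by
    rw [hI, hS', unitaryDiag_mul hU]
    congr 1
    ext i
    split_ifs with h <;> simp
  have hσI : σ * I = σ := by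
    rw [hI, hσU, unitaryDiag_mul hU]
    congr 1
    ext i
    split_ifs with h <;> simp [h]
  have hρI : ρ * I = ρ := hsupp.mul_eq hσI
  have hIρ : I * ρ = ρ := by
    have := congrArg conjTranspose hρI
    rwa [conjTranspose_mul, hρ.1.isHermitian.eq, hI, unitaryDiag_conjTranspose] at this
  have hA : (S' * ρ * S').PosSemidef := by
    have := hρ.1.mul_mul_conjTranspose_same S'
    rwa [hS', unitaryDiag_conjTranspose] at this
  have ha := hA.eigenvalues_nonneg
  set a := hA.isHermitian.eigenvalues with ha_def
  have hV := hA.isHermitian.eigenvectorUnitary.2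
  set V := (hA.isHermitian.eigenvectorUnitary : Matrix (Fin d) (Fin d) ℂ) with hV_def
  have hAV : S' * ρ * S' = unitaryDiag V a := exists_unitaryDiag_of_isHermitian _
  have hρS : ρ = S * unitaryDiag V a * S := by
    rw [← hAV]
    calc ρ = I * ρ * I := by rw [hIρ, hρI]
      _ = (S * S') * ρ * (S' * S) := by rw [hSS', hS'S]
      _ = _ := by simp only [mul_assoc]
  refine ⟨U, hU, V, hV, l, a, hl, ha, hσU, hρS, ?_, ?_, ?_⟩
  · rw [← hAV, mul_assoc, hS'I]
  · refine (sum_nonneg fun i _ => Real.rpow_nonneg (ha i) _).lt_of_ne' fun h0 => ?_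
    have h1 := (sum_eq_zero_iff_of_nonneg fun i _ => Real.rpow_nonneg (ha i) _).1 h0
    have h2 : a = fun _ => 0 := by
      ext i
      exact ((Real.rpow_eq_zero_iff_of_nonneg (ha i)).1 (h1 i (mem_univ i))).1
    have h3 : ρ = 0 := by
      rw [hρS, h2]
      simp [unitaryDiag]
    have h4 := hρ.2
    rw [h3, trace_zero] at h4
    exact zero_ne_one h4
  · rw [Qstar, if_neg (fun h => h.2 hsupp), hpow, matPow, matFun_eq_unitaryDiag hA.isHermitian,
      trace_unitaryDiag hV, Complex.ofReal_re]
    congr 1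
    refine sum_congr rfl fun i _ => ?_
    split_ifs with h
    · rw [← ha_def] at h
      rw [h, Real.zero_rpow hα0.ne']
    · rfl

/-- The tensor-power bounds behind both inequalities between `cutoffRate` and `Dstar`. -/
theorem exists_test_bounds {ρ σ : Matrix (Fin d) (Fin d) ℂ} (hρ : IsDensityMatrix ρ)
    (hσ : IsDensityMatrix σ) (hsupp : suppLE ρ σ) {κ : ℝ} (hκ : κ ∈ Set.Ioo (0 : ℝ) 1) :
    ∃ Q : ℝ, 0 < Q ∧ Qstar (1 / (1 - κ)) ρ σ = ENNReal.ofReal Q ∧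
      (∀ (N : ℕ) T, IsTest T → (tensorPow ρ N * T).trace.re ≤
        (Q ^ N) ^ (1 - κ) * (tensorPow σ N * T).trace.re ^ κ) ∧
      ∃ ε : ℝ, 0 < ε ∧ ∀ N : ℕ, ∃ T, IsTest T ∧
        0 < (tensorPow ρ N * T).trace.re ∧ ε ^ N ≤ (tensorPow σ N * T).trace.re ∧
        (Q ^ N) ^ (1 - κ) ≤ (((N + 1 : ℝ) ^ d) ^ 2 * (harmonic (d ^ N) : ℝ) ^ (1 - κ)) *
          ((tensorPow ρ N * T).trace.re * (tensorPow σ N * T).trace.re ^ (-κ)) := by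
  obtain ⟨U, hU, V, hV, l, a, hl, ha, hσU, hρS, hI, hpos, hQ⟩ :=
    exists_spectral_data hρ hσ hsupp hκ
  refine ⟨_, hpos, hQ, fun N T hT => ?_, ?_⟩
  · have h := re_trace_mul_test_le (tensorPow_mem_unitary hU N) (tensorPow_mem_unitary hV N)
      (l := fun x => ∏ i, l (x i)) (a := fun x => ∏ i, a (x i))
      (fun x => prod_nonneg fun i _ => hl _) (fun x => prod_nonneg fun i _ => ha _) hT hκ
    simp only [← Real.finsetProd_rpow univ _ (fun i _ => hl _)] at h
    rw [← tensorPow_unitaryDiag U fun i => l i ^ (κ / 2), ← tensorPow_unitaryDiag V a,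
      ← tensorPow_unitaryDiag U l, ← tensorPow_mul, ← tensorPow_mul, ← hσU, ← hρS] at h
    rwa [sum_prod_rpow ha] at h
  · obtain ⟨ε, hε, hεl⟩ : ∃ ε : ℝ, 0 < ε ∧ ∀ i, l i ≠ 0 → ε ≤ l i := by
      rcases ({i | l i ≠ 0} : Finset (Fin d)).eq_empty_or_nonempty with h | h
      · refine ⟨1, one_pos, fun i hi => ?_⟩
        have : i ∈ ({i | l i ≠ 0} : Finset (Fin d)) := by simpa using hi
        simp [h] at this
      · obtain ⟨i, hi, hmin⟩ := exists_min_image _ l h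
        exact ⟨l i, (hl i).lt_of_ne' (mem_filter.1 hi).2,
          fun j hj => hmin j (by simpa using hj)⟩
    refine ⟨ε, hε, fun N => ?_⟩
    have hprod : ∀ x : Fin N → Fin d,
        ∏ i, l (x i) = ∏ j, l j ^ #{i | x i = j} := by
      intro x
      rw [← prod_fiberwise_of_maps_to (g := x) (t := univ) (fun _ _ => mem_univ _)]
      refine prod_congr rfl fun j _ => ?_
      rw [prod_congr rfl (g := fun _ => l j), prod_const]
      intro i hi
      rw [(mem_filter.1 hi).2]
    have hind : ∀ x : Fin N → Fin d, (if ∏ i, l (x i) = 0 then (0 : ℝ) else 1) =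
        ∏ i, if l (x i) = 0 then 0 else 1 := by
      intro x
      split_ifs with h
      · obtain ⟨i, -, hi⟩ := prod_eq_zero_iff.1 h
        exact (prod_eq_zero (mem_univ i) (by simp [hi])).symm
      · refine (prod_eq_one fun i _ => if_neg fun hi => h ?_).symm
        exact prod_eq_zero (mem_univ i) hi
    obtain ⟨T, hT, P, R, hP, hR, ⟨x, hx0, hxR⟩, hP0, hle⟩ := exists_test_of_pinching
      (τ := Fin d → Fin (N + 1)) (tensorPow_mem_unitary hU N) (tensorPow_mem_unitary hV N)
      (l := fun x : Fin N → Fin d => ∏ i, l (x i)) (a := fun x : Fin N → Fin d => ∏ i, a (x i))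
      (fun x => prod_nonneg fun i _ => hl _) (fun x => prod_nonneg fun i _ => ha _)
      (fun x j => ⟨#{i | x i = j}, by
        have := card_le_univ ({i | x i = j} : Finset (Fin N))
        rw [Fintype.card_fin] at this
        omega⟩)
      (fun x y hxy => by
        rw [hprod, hprod]
        refine prod_congr rfl fun j _ => ?_
        have := congrArg Fin.val (congrFun hxy j)
        dsimp only at this
        rw [this])
      (by
        simp only [hind]
        rw [← tensorPow_unitaryDiag V a,
          ← tensorPow_unitaryDiag U fun i => if l i = 0 then 0 else 1, ← tensorPow_mul, hI])
      hκ (by rw [sum_prod_rpow ha]; positivity)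
    simp only [← Real.finsetProd_rpow univ _ (fun i _ => hl _)] at hP
    rw [← tensorPow_unitaryDiag U fun i => l i ^ (κ / 2), ← tensorPow_unitaryDiag V a,
      ← tensorPow_mul, ← tensorPow_mul, ← hρS] at hP
    rw [← tensorPow_unitaryDiag U l, ← hσU] at hR
    subst hP hR
    refine ⟨T, hT, hP0, le_trans ?_ hxR, ?_⟩
    · calc ε ^ N = ∏ _i : Fin N, ε := by simp
        _ ≤ _ := prod_le_prod (fun _ _ => hε.le) fun i _ => hεl _ fun h =>
          hx0.ne' (prod_eq_zero (mem_univ i) h)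
    · rw [sum_prod_rpow ha] at hle
      simpa using hle

theorem posSemidef_tensorPow {A : Matrix (Fin d) (Fin d) ℂ} (hA : A.PosSemidef) (N : ℕ) :
    (tensorPow A N).PosSemidef := by
  obtain ⟨K, hK, rfl⟩ := exists_hermitian_mul_self_eq hA
  conv => enter [1, 1, 1]; rw [← hK]
  rw [tensorPow_mul, tensorPow_conjTranspose]
  exact posSemidef_conjTranspose_mul_self _

theorem trace_tensorPow (A : Matrix (Fin d) (Fin d) ℂ) (N : ℕ) :
    (tensorPow A N).trace = A.trace ^ N := by
  simp only [trace, diag_apply, tensorPow, of_apply, Fintype.sum_pow]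

theorem re_trace_tensorPow_mul_test_le_one {σ : Matrix (Fin d) (Fin d) ℂ}
    (hσ : IsDensityMatrix σ) {N : ℕ} {T : Matrix (Fin N → Fin d) (Fin N → Fin d) ℂ}
    (hT : IsTest T) : (tensorPow σ N * T).trace.re ≤ 1 := by
  have h := re_trace_mul_nonneg (posSemidef_tensorPow hσ.1 N) hT.2
  rw [mul_sub, mul_one, trace_sub, trace_tensorPow, hσ.2, one_pow, Complex.sub_re,
    Complex.one_re] at h
  linarith

theorem IsDensityMatrix.dim_pos {σ : Matrix (Fin d) (Fin d) ℂ} (hσ : IsDensityMatrix σ) :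
    0 < d := by
  rcases Nat.eq_zero_or_pos d with rfl | h
  · have := hσ.2
    simp at this
  · exact h

theorem expRate_of_ne_zero (N : ℕ) {x : ℝ} (hx : x ≠ 0) :
    expRate N x = ((-(N : ℝ)⁻¹ * Real.log x : ℝ) : EReal) :=
  if_neg hx

theorem Dstar_eq_coe {ρ σ : Matrix (Fin d) (Fin d) ℂ} {Q κ : ℝ} (hκ : κ ∈ Set.Ioo (0 : ℝ) 1)
    (hQ : 0 < Q) (h : Qstar (1 / (1 - κ)) ρ σ = ENNReal.ofReal Q) :
    Dstar (1 / (1 - κ)) ρ σ = (((1 - κ) / κ * Real.log Q : ℝ) : EReal) := by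
  have hκ1 : 1 - κ ≠ 0 := (sub_pos.2 hκ.2).ne'
  have e : (1 / (1 - κ) - 1)⁻¹ = (1 - κ) / κ := by
    rw [div_sub_one hκ1, sub_sub_cancel, inv_div]
  rw [Dstar, h, ENNReal.log_ofReal, if_neg hQ.not_ge, e, EReal.coe_mul]

theorem le_expRate_of_le {Q κ p q r : ℝ} {N : ℕ} (hN : 0 < N) (hκ : κ ∈ Set.Ioo (0 : ℝ) 1)
    (hQ : 0 < Q) (hp : 0 ≤ p) (hq : 0 ≤ q) (hpq : p ≤ (Q ^ N) ^ (1 - κ) * q ^ κ)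
    (hr : (r : EReal) ≤ expRate N q) :
    ((κ * (r - (1 - κ) / κ * Real.log Q) : ℝ) : EReal) ≤ expRate N p := by
  rcases hp.eq_or_lt with rfl | hp
  · simp [expRate]
  have hq : 0 < q := by
    refine hq.lt_of_ne' fun h => ?_
    rw [h, Real.zero_rpow hκ.1.ne', mul_zero] at hpq
    exact hp.not_ge hpq
  rw [expRate_of_ne_zero N hq.ne', EReal.coe_le_coe_iff] at hr
  rw [expRate_of_ne_zero N hp.ne', EReal.coe_le_coe_iff]
  have h1 := Real.log_le_log hp hpq
  rw [Real.log_mul (by positivity) (by positivity), Real.log_rpow (by positivity),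
    Real.log_rpow hq, Real.log_pow] at h1
  have hN' : (0 : ℝ) < N := by exact_mod_cast hN
  have e : κ * (r - (1 - κ) / κ * Real.log Q) = κ * r - (1 - κ) * Real.log Q := by
    have := hκ.1.ne'
    field_simp
  rw [e]
  have h2 : (N : ℝ)⁻¹ * Real.log p ≤
      (N : ℝ)⁻¹ * ((1 - κ) * (N * Real.log Q) + κ * Real.log q) :=
    mul_le_mul_of_nonneg_left h1 (by positivity)
  have h3 := mul_le_mul_of_nonneg_left hr hκ.1.le
  have e2 : (N : ℝ)⁻¹ * ((1 - κ) * (N * Real.log Q) + κ * Real.log q) =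
      (1 - κ) * Real.log Q + κ * ((N : ℝ)⁻¹ * Real.log q) := by
    field_simp
  rw [e2] at h2
  linarith

theorem le_scLow {ρ σ : Matrix (Fin d) (Fin d) ℂ} (hρ : ρ.PosSemidef) (hσ : σ.PosSemidef)
    {Q κ : ℝ} (hκ : κ ∈ Set.Ioo (0 : ℝ) 1) (hQ : 0 < Q)
    (h : ∀ (N : ℕ) T, IsTest T → (tensorPow ρ N * T).trace.re ≤
        (Q ^ N) ^ (1 - κ) * (tensorPow σ N * T).trace.re ^ κ) (r : ℝ) :
    ((κ * (r - (1 - κ) / κ * Real.log Q) : ℝ) : EReal) ≤ scLow r ρ σ := by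
  refine le_sInf ?_
  rintro _ ⟨T, hT, hr, rfl⟩
  refine le_of_forall_lt fun y hy => ?_
  obtain ⟨z, hyz, hz⟩ := EReal.lt_iff_exists_real_btwn.1 hy
  refine hyz.trans_le ?_
  rw [EReal.coe_lt_coe_iff] at hz
  set D := (1 - κ) / κ * Real.log Q with hD
  have hr' : ((z / κ + D : ℝ) : EReal) < r := by
    rw [EReal.coe_lt_coe_iff]
    have : z / κ < r - D := by
      rw [div_lt_iff₀ hκ.1]
      linarith
    linarith
  refine Filter.le_liminf_of_le (by isBoundedDefault) ?_
  filter_upwards [Filter.eventually_lt_of_lt_liminf (hr'.trans_le hr),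
    Filter.eventually_gt_atTop 0] with N hN hN0
  have := le_expRate_of_le hN0 hκ hQ
    (re_trace_mul_nonneg (posSemidef_tensorPow hρ N) (hT N).1)
    (re_trace_mul_nonneg (posSemidef_tensorPow hσ N) (hT N).1) (h N _ (hT N)) hN.le
  rwa [← hD, add_sub_cancel_right, mul_div_cancel₀ _ hκ.1.ne'] at this

theorem log_harmonic_pow_le (hd : 0 < d) (N : ℕ) :
    Real.log (harmonic (d ^ N) : ℝ) ≤ Real.log (1 + Real.log d) + Real.log (N + 1) := by
  have hlog : 0 ≤ Real.log d := Real.log_natCast_nonneg d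
  have hpos : (0 : ℝ) < harmonic (d ^ N) := by
    exact_mod_cast harmonic_pos (pow_pos hd N).ne'
  rw [← Real.log_mul (by positivity) (by positivity)]
  refine Real.log_le_log hpos ((harmonic_le_one_add_log _).trans ?_)
  push_cast
  rw [Real.log_pow]
  nlinarith [(Nat.cast_nonneg N : (0 : ℝ) ≤ N)]

theorem neg_inv_mul_log_le {Q κ P R c : ℝ} {N : ℕ} (hN : 0 < N) (hd : 0 < d)
    (hκ : κ ∈ Set.Ioo (0 : ℝ) 1) (hQ : 0 < Q) (hP : 0 < P) (hR : 0 < R)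
    (hc : c = (2 * d + 1) * Real.log (N + 1) + Real.log (1 + Real.log d))
    (h : (Q ^ N) ^ (1 - κ) ≤ (((N + 1 : ℝ) ^ d) ^ 2 * (harmonic (d ^ N) : ℝ) ^ (1 - κ)) *
      (P * R ^ (-κ))) :
    -(N : ℝ)⁻¹ * Real.log P ≤
      κ * (-(N : ℝ)⁻¹ * Real.log R - (1 - κ) / κ * Real.log Q) + (N : ℝ)⁻¹ * c := by
  have hH : (0 : ℝ) < harmonic (d ^ N) := by
    exact_mod_cast harmonic_pos (pow_pos hd N).ne'
  have hκ1 : 0 < 1 - κ := sub_pos.2 hκ.2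
  have hN' : (0 : ℝ) < N := by exact_mod_cast hN
  have h1 := Real.log_le_log (by positivity) h
  have hHκ := Real.rpow_pos_of_pos hH (1 - κ)
  have hRκ := Real.rpow_pos_of_pos hR (-κ)
  rw [Real.log_mul (by positivity) (by positivity), Real.log_mul (by positivity) (by positivity),
    Real.log_mul (by positivity) (by positivity), Real.log_rpow (by positivity), Real.log_rpow hH,
    Real.log_rpow hR, Real.log_pow, Real.log_pow, Real.log_pow] at h1
  have hlog : 0 ≤ Real.log d := Real.log_natCast_nonneg d
  have h2 : (1 - κ) * Real.log (harmonic (d ^ N) : ℝ) ≤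
      Real.log (1 + Real.log d) + Real.log (N + 1) := by
    have h3 : 0 ≤ Real.log (1 + Real.log d) := Real.log_nonneg (by linarith)
    have h4 : 0 ≤ Real.log ((N : ℝ) + 1) := Real.log_nonneg (by linarith)
    exact (mul_le_mul_of_nonneg_left (log_harmonic_pow_le hd N) hκ1.le).trans
      (mul_le_of_le_one_left (by linarith) (by linarith [hκ.1]))
  have h3 : (1 - κ) * (N * Real.log Q) ≤ c + Real.log P - κ * Real.log R := by
    rw [hc]
    push_cast at h1
    linarith
  have h4 := mul_le_mul_of_nonneg_left h3 (inv_pos.2 hN').le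
  have e1 : (N : ℝ)⁻¹ * ((1 - κ) * (N * Real.log Q)) = (1 - κ) * Real.log Q := by field_simp
  have e2 : κ * (-(N : ℝ)⁻¹ * Real.log R - (1 - κ) / κ * Real.log Q) =
      -(N : ℝ)⁻¹ * (κ * Real.log R) - (1 - κ) * Real.log Q := by
    have := hκ.1.ne'
    field_simp
  rw [e1] at h4
  rw [e2]
  linarith

theorem tendsto_inv_mul_log_add (A B : ℝ) :
    Filter.Tendsto (fun N : ℕ => (N : ℝ)⁻¹ * (A * Real.log (N + 1) + B)) Filter.atTop
      (nhds 0) := by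
  have hlog : Filter.Tendsto (fun N : ℕ => Real.log (N + 1) / (N : ℝ)) Filter.atTop (nhds 0) := by
    have h := (Real.tendsto_pow_log_div_mul_add_atTop 1 (-1) 1 one_ne_zero).comp
      (Filter.tendsto_atTop_add_const_right _ (1 : ℝ) tendsto_natCast_atTop_atTop)
    refine h.congr fun N => ?_
    simp
  have h := (hlog.const_mul A).add ((tendsto_inv_atTop_nhds_zero_nat (𝕜 := ℝ)).const_mul B)
  simp only [mul_zero, add_zero] at h
  refine h.congr fun N => ?_
  ring

theorem le_of_forall_le_scLow {ρ σ : Matrix (Fin d) (Fin d) ℂ} (hσ : IsDensityMatrix σ)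
    {Q κ ε : ℝ} (hκ : κ ∈ Set.Ioo (0 : ℝ) 1) (hQ : 0 < Q) (hε : 0 < ε)
    (h : ∀ N : ℕ, ∃ T, IsTest T ∧
        0 < (tensorPow ρ N * T).trace.re ∧ ε ^ N ≤ (tensorPow σ N * T).trace.re ∧
        (Q ^ N) ^ (1 - κ) ≤ (((N + 1 : ℝ) ^ d) ^ 2 * (harmonic (d ^ N) : ℝ) ^ (1 - κ)) *
          ((tensorPow ρ N * T).trace.re * (tensorPow σ N * T).trace.re ^ (-κ))) {r₀ : ℝ}
    (hr₀ : ∀ r : ℝ, ((κ * (r - r₀) : ℝ) : EReal) ≤ scLow r ρ σ) :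
    (1 - κ) / κ * Real.log Q ≤ r₀ := by
  choose T hT hP hR hle using h
  have hR0 : ∀ N, 0 < (tensorPow σ N * T N).trace.re := fun N => (pow_pos hε N).trans_le (hR N)
  have hB0 : 0 ≤ Filter.liminf (fun N => expRate N ((tensorPow σ N * T N).trace.re))
      Filter.atTop := by
    refine Filter.le_liminf_of_le (by isBoundedDefault) (Filter.Eventually.of_forall fun N => ?_)
    rw [expRate_of_ne_zero _ (hR0 N).ne', ← EReal.coe_zero, EReal.coe_le_coe_iff, neg_mul,
      neg_nonneg]
    exact mul_nonpos_of_nonneg_of_nonpos (by positivity)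
      (Real.log_nonpos (hR0 N).le (re_trace_tensorPow_mul_test_le_one hσ (hT N)))
  have hB1 : Filter.liminf (fun N => expRate N ((tensorPow σ N * T N).trace.re))
      Filter.atTop ≤ ((-Real.log ε : ℝ) : EReal) := by
    refine Filter.liminf_le_of_frequently_le' (Filter.Eventually.frequently ?_)
    filter_upwards [Filter.eventually_gt_atTop 0] with N hN
    have hN' : (0 : ℝ) < N := by exact_mod_cast hN
    rw [expRate_of_ne_zero _ (hR0 N).ne', EReal.coe_le_coe_iff, neg_mul, neg_le_neg_iff,
      le_inv_mul_iff₀ hN', ← Real.log_pow]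
    exact Real.log_le_log (pow_pos hε N) (hR N)
  set B := Filter.liminf (fun N => expRate N ((tensorPow σ N * T N).trace.re)) Filter.atTop
    with hB
  obtain ⟨b, hb⟩ : ∃ b : ℝ, (b : EReal) = B :=
    ⟨B.toReal, EReal.coe_toReal (hB1.trans_lt (EReal.coe_lt_top _)).ne
      ((EReal.bot_lt_zero).trans_le hB0).ne'⟩
  have hsc : ((κ * (b - r₀) : ℝ) : EReal) ≤
      Filter.liminf (fun N => expRate N ((tensorPow ρ N * T N).trace.re)) Filter.atTop :=
    (hr₀ b).trans (sInf_le ⟨T, hT, hb.le, rfl⟩)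
  by_contra! hlt
  set D := (1 - κ) / κ * Real.log Q with hD
  have hδ : 0 < κ * (D - r₀) / 4 := by
    have := mul_pos hκ.1 (sub_pos.2 hlt)
    linarith
  set δ := κ * (D - r₀) / 4 with hδ_def
  have h1 : ((κ * (b - r₀) - δ : ℝ) : EReal) <
      Filter.liminf (fun N => expRate N ((tensorPow ρ N * T N).trace.re)) Filter.atTop :=
    lt_of_lt_of_le (EReal.coe_lt_coe_iff.2 (by linarith)) hsc
  have h2 : Filter.liminf (fun N => expRate N ((tensorPow σ N * T N).trace.re)) Filter.atTop <
      ((b + δ : ℝ) : EReal) := by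
    rw [← hB, ← hb, EReal.coe_lt_coe_iff]
    linarith
  have h3 := (tendsto_inv_mul_log_add (2 * d + 1) (Real.log (1 + Real.log d))).eventually_lt_const
    hδ
  obtain ⟨N, hN2, hN1, hN3, hN0⟩ := ((Filter.frequently_lt_of_liminf_lt (by isBoundedDefault)
    h2).and_eventually ((Filter.eventually_lt_of_lt_liminf h1).and
      (h3.and (Filter.eventually_gt_atTop 0)))).exists
  rw [expRate_of_ne_zero _ (hR0 N).ne', EReal.coe_lt_coe_iff] at hN2
  rw [expRate_of_ne_zero _ (hP N).ne', EReal.coe_lt_coe_iff] at hN1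
  have hmain := neg_inv_mul_log_le hN0 hσ.dim_pos hκ hQ (hP N) (hR0 N) rfl (hle N)
  rw [← hD] at hmain
  have h5 := mul_lt_mul_of_pos_left hN2 hκ.1
  have h6 := mul_lt_mul_of_pos_right hκ.2 hδ
  have h7 : κ * (D - r₀) = 4 * δ := by rw [hδ_def]; ring
  linarith

end TensorPow

end QRD

open QRD in
/-- For density matrices `ρ`, `σ` on `ℂ^d` with `s(ρ) ≤ s(σ)` and `κ ∈ (0,1)`, the
generalized `κ`-cutoff rate equals the sandwiched Rényi divergence:
`C_κ(ρ‖σ) = D*_{1/(1−κ)}(ρ‖σ)`. -/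
theorem cutoffRate_eq_Dstar
    {d : ℕ} (ρ σ : Matrix (Fin d) (Fin d) ℂ)
    (hρ : IsDensityMatrix ρ) (hσ : IsDensityMatrix σ)
    (hsupp : suppLE ρ σ) (κ : ℝ) (hκ : κ ∈ Set.Ioo (0 : ℝ) 1) :
    cutoffRate κ ρ σ = Dstar (1 / (1 - κ)) ρ σ := by
  obtain ⟨Q, hQ, hQeq, hconv, ε, hε, hach⟩ := exists_test_bounds hρ hσ hsupp hκ
  rw [Dstar_eq_coe hκ hQ hQeq, cutoffRate]
  refine le_antisymm (sInf_le ⟨_, le_scLow hρ.1 hσ.1 hκ hQ hconv, rfl⟩) (le_sInf ?_)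
  rintro _ ⟨r₀, hr₀, rfl⟩
  exact EReal.coe_le_coe_iff.2 (le_of_forall_le_scLow hσ hκ hQ hε hach hr₀)
end

section
/- Let μ₁ and μ₂ be probability measures on the interval [0,1] and let α ∈ (0,+∞). Set ν := μ₁ + μ₂ and let f := dμ₁/dν and g := dμ₂/dν be the Radon–Nikodym derivatives. Then, with all quantities taken in [0,+∞], lim_{n→∞} Σ_{k=0}^{n} C(n,k) · (∫ λ^k (1−λ)^{n−k} dμ₁(λ))^α · (∫ λ^k (1−λ)^{n−k} dμ₂(λ))^{1−α} = ∫ f(λ)^α g(λ)^{1−α} dν(λ). -/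
open scoped ENNReal
open MeasureTheory

section Auxiliary

open Filter Topology unitInterval

/-- The mean of `f` under the measure with density `w` with respect to `ν`. -/
noncomputable def weightedMean {X : Type*} [MeasurableSpace X] (ν : Measure X) (w f : X → ℝ) : ℝ :=
  (∫ t, w t * f t ∂ν) / ∫ t, w t ∂ν

section WeightedMean

variable {X : Type*} [MeasurableSpace X] {ν : Measure X} {w f : X → ℝ}

lemma weightedMean_mul_integral (hw : 0 ≤ w) (hwi : Integrable w ν) :
    weightedMean ν w f * ∫ t, w t ∂ν = ∫ t, w t * f t ∂ν := by
  by_cases h : ∫ t, w t ∂ν = 0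
  · have h0 : w =ᵐ[ν] 0 := (integral_eq_zero_iff_of_nonneg hw hwi).1 h
    have : ∫ t, w t * f t ∂ν = ∫ _, (0 : ℝ) ∂ν :=
      integral_congr_ae (by filter_upwards [h0] with t ht; simp [ht])
    simp [h, this]
  · exact div_mul_cancel₀ _ h

lemma weightedMean_mem_Icc (hw : 0 ≤ w) (hwi : Integrable w ν)
    (hwf : Integrable (fun t => w t * f t) ν) (hf : ∀ t, f t ∈ Set.Icc (0 : ℝ) 1) :
    weightedMean ν w f ∈ Set.Icc (0 : ℝ) 1 := by
  have hW : 0 ≤ ∫ t, w t ∂ν := integral_nonneg hw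
  refine ⟨div_nonneg (integral_nonneg fun t => mul_nonneg (hw t) (hf t).1) hW,
    div_le_one_of_le₀ (integral_mono hwf hwi fun t => ?_) hW⟩
  exact mul_le_of_le_one_right (hw t) (hf t).2

lemma integral_mul_sub_weightedMean_sq_le (hw : 0 ≤ w) (hwi : Integrable w ν)
    (hwf : Integrable (fun t => w t * f t) ν) (hwf2 : Integrable (fun t => w t * f t ^ 2) ν)
    (x : ℝ) :
    ∫ t, w t * (f t - weightedMean ν w f) ^ 2 ∂ν ≤ ∫ t, w t * (f t - x) ^ 2 ∂ν := by
  have expand (y : ℝ) : ∫ t, w t * (f t - y) ^ 2 ∂ν =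
      ∫ t, w t * f t ^ 2 ∂ν - 2 * y * ∫ t, w t * f t ∂ν + y ^ 2 * ∫ t, w t ∂ν := by
    have hsub : Integrable (fun t => w t * f t ^ 2 - 2 * y * (w t * f t)) ν :=
      hwf2.sub (hwf.const_mul _)
    rw [← integral_const_mul, ← integral_const_mul, ← integral_sub hwf2 (hwf.const_mul _),
      ← integral_add hsub (hwi.const_mul _)]
    exact integral_congr_ae (.of_forall fun t => by ring)
  have hW : 0 ≤ ∫ t, w t ∂ν := integral_nonneg hw
  rw [expand, expand, ← weightedMean_mul_integral (f := f) hw hwi]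
  nlinarith [mul_nonneg hW (sq_nonneg (x - weightedMean ν w f))]

end WeightedMean

section Bernstein

variable {ν : Measure I} {f : I → ℝ}

lemma integrable_bernstein_mul {g : I → ℝ} (n k : ℕ) (hg : Integrable g ν) :
    Integrable (fun t => bernstein n k t * g t) ν :=
  hg.bdd_mul (c := ‖bernstein n k‖) (bernstein n k).continuous.aestronglyMeasurable
    (.of_forall fun t => (bernstein n k).norm_coe_le_norm t)

lemma integral_sum_bernstein_mul {g : I → ℝ} (n : ℕ) (hg : Integrable g ν) :
    ∑ k : Fin (n + 1), ∫ t, bernstein n k t * g t ∂ν = ∫ t, g t ∂ν := by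
  rw [← integral_finsetSum _ fun (k : Fin (n + 1)) _ => integrable_bernstein_mul n k hg]
  simp_rw [← Finset.sum_mul, bernstein.probability, one_mul]

variable [IsFiniteMeasure ν]

lemma integrable_of_mem_Icc_zero_one (hf : Measurable f) (h : ∀ t, f t ∈ Set.Icc (0 : ℝ) 1) :
    Integrable f ν :=
  .of_bound hf.aestronglyMeasurable 1 (.of_forall fun t => by
    rw [Real.norm_of_nonneg (h t).1]; exact (h t).2)

lemma integrable_bernstein (n k : ℕ) : Integrable (bernstein n k) ν := by
  simpa using integrable_bernstein_mul (ν := ν) n k (integrable_const (1 : ℝ))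

/-- A continuous function varies little, in mean square, under Bernstein resampling. -/
lemma tendsto_sum_integral_bernstein_sub_sq (ν : Measure I) [IsFiniteMeasure ν] (h : C(I, ℝ)) :
    Tendsto (fun n : ℕ => ∑ k : Fin (n + 1),
      ∫ t, bernstein n k t * (h t - h (bernstein.z k)) ^ 2 ∂ν) atTop (𝓝 0) := by
  let u : ℕ → C(I, ℝ) := fun n =>
    bernsteinApproximation n (h * h) - 2 * h * bernsteinApproximation n h + h * h
  have hu : Tendsto (fun n => ∫ t, u n t ∂ν) atTop (𝓝 0) := by
    have h1 : Tendsto u atTop (𝓝 (h * h - 2 * h * h + h * h)) :=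
      ((bernsteinApproximation_uniform (h * h)).sub
        ((bernsteinApproximation_uniform h).const_mul (2 * h))).add_const _
    have h2 : h * h - 2 * h * h + h * h = 0 := by ring
    rw [h2] at h1
    have h3 := (tendsto_norm_zero.comp h1).mul_const (ν.real Set.univ)
    rw [zero_mul] at h3
    exact squeeze_zero_norm (fun n => norm_integral_le_of_norm_le_const
      (.of_forall fun t => (u n).norm_coe_le_norm t)) h3
  refine hu.congr fun n => ?_
  rw [← integral_finsetSum _ fun (k : Fin (n + 1)) _ => integrable_bernstein_mul n k ?_]
  · refine integral_congr_ae (.of_forall fun t => ?_)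
    have hp := bernstein.probability n t
    simp only [u, ContinuousMap.add_apply, ContinuousMap.sub_apply, ContinuousMap.mul_apply,
      bernsteinApproximation.apply, smul_eq_mul]
    have : h t * h t = ∑ k : Fin (n + 1), bernstein n k t * (h t * h t) := by
      rw [← Finset.sum_mul, hp, one_mul]
    rw [this, Finset.mul_sum, ← Finset.sum_sub_distrib, ← Finset.sum_add_distrib]
    refine Finset.sum_congr rfl fun k _ => ?_
    have : (2 : C(I, ℝ)) t = 2 := rfl
    rw [this]; ring
  · exact (show Continuous fun t => (h t - h (bernstein.z k)) ^ 2 by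
      fun_prop).integrable_of_hasCompactSupport (HasCompactSupport.of_compactSpace _)

/-- The posterior means of `f` given the Bernstein index have vanishing quadratic error. -/
lemma tendsto_sum_integral_bernstein_sub_weightedMean_sq (hf : Measurable f)
    (hf1 : ∀ t, f t ∈ Set.Icc (0 : ℝ) 1) :
    Tendsto (fun n : ℕ => ∑ k : Fin (n + 1),
      ∫ t, bernstein n k t * (f t - weightedMean ν (bernstein n k) f) ^ 2 ∂ν) atTop (𝓝 0) := by
  have nonneg (n : ℕ) : 0 ≤ ∑ k : Fin (n + 1),
      ∫ t, bernstein n k t * (f t - weightedMean ν (bernstein n k) f) ^ 2 ∂ν :=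
    Finset.sum_nonneg fun k _ => integral_nonneg fun t => mul_nonneg bernstein_nonneg (sq_nonneg _)
  refine tendsto_order.2 ⟨fun a ha => .of_forall fun n => ha.trans_le (nonneg n), fun ε hε => ?_⟩
  have hfi : Integrable f ν := integrable_of_mem_Icc_zero_one hf hf1
  have hf2i : Integrable (fun t => f t ^ 2) ν := integrable_of_mem_Icc_zero_one (hf.pow_const 2)
    fun t => ⟨sq_nonneg _, pow_le_one₀ (hf1 t).1 (hf1 t).2⟩
  have hfL : MemLp f (ENNReal.ofReal 2) ν := .of_bound hf.aestronglyMeasurable 1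
    (.of_forall fun t => by rw [Real.norm_of_nonneg (hf1 t).1]; exact (hf1 t).2)
  obtain ⟨g, hg, hgL⟩ := hfL.exists_boundedContinuous_integral_rpow_sub_le two_pos
    (show 0 < ε / 8 by positivity)
  have hfg : ∫ t, (f t - g t) ^ 2 ∂ν ≤ ε / 8 := by
    simpa using hg
  have hfgi : Integrable (fun t => (f t - g t) ^ 2) ν := by
    have := (hfL.sub hgL)
    rw [show ENNReal.ofReal 2 = 2 by norm_num] at this
    exact this.integrable_sq
  filter_upwards [(tendsto_sum_integral_bernstein_sub_sq ν g.toContinuousMap).eventually_lt_const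
    (show 0 < ε / 4 by positivity)] with n hn
  have hgi (k : Fin (n + 1)) : Integrable (fun t => (g t - g (bernstein.z k)) ^ 2) ν :=
    (show Continuous fun t => (g t - g (bernstein.z k)) ^ 2 by
      fun_prop).integrable_of_hasCompactSupport (HasCompactSupport.of_compactSpace _)
  calc ∑ k : Fin (n + 1),
        ∫ t, bernstein n k t * (f t - weightedMean ν (bernstein n k) f) ^ 2 ∂ν
      ≤ ∑ k : Fin (n + 1), (2 * (∫ t, bernstein n k t * (f t - g t) ^ 2 ∂ν) +
          2 * ∫ t, bernstein n k t * (g t - g (bernstein.z k)) ^ 2 ∂ν) := by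
        refine Finset.sum_le_sum fun k _ => ?_
        refine (integral_mul_sub_weightedMean_sq_le (fun t => bernstein_nonneg)
          (integrable_bernstein n k) (integrable_bernstein_mul n k hfi)
          (integrable_bernstein_mul n k hf2i) (g (bernstein.z k))).trans ?_
        rw [← integral_const_mul, ← integral_const_mul,
          ← integral_add ((integrable_bernstein_mul n k hfgi).const_mul 2)
            ((integrable_bernstein_mul n k (hgi k)).const_mul 2)]
        refine integral_mono_of_nonneg
          (.of_forall fun t => mul_nonneg bernstein_nonneg (sq_nonneg _))
          (((integrable_bernstein_mul n k hfgi).const_mul 2).add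
            ((integrable_bernstein_mul n k (hgi k)).const_mul 2)) (.of_forall fun t => ?_)
        have hb : 0 ≤ bernstein n k t := bernstein_nonneg
        simp only
        nlinarith [mul_nonneg hb (sq_nonneg ((f t - g t) - (g t - g (bernstein.z k))))]
    _ = 2 * (∫ t, (f t - g t) ^ 2 ∂ν) + 2 * ∑ k : Fin (n + 1),
          ∫ t, bernstein n k t * (g t - g (bernstein.z k)) ^ 2 ∂ν := by
        rw [Finset.sum_add_distrib, ← Finset.mul_sum, ← Finset.mul_sum,
          integral_sum_bernstein_mul n hfgi]
    _ < ε := by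
        simp only [BoundedContinuousFunction.coe_toContinuousMap] at hn
        linarith

lemma ContinuousOn.exists_abs_sub_le_add_mul_sq {φ : ℝ → ℝ} {s : Set ℝ} (hs : IsCompact s)
    (hφ : ContinuousOn φ s) {ε : ℝ} (hε : 0 < ε) :
    ∃ C, 0 ≤ C ∧ ∀ x ∈ s, ∀ y ∈ s, |φ x - φ y| ≤ ε + C * (y - x) ^ 2 := by
  obtain ⟨M, hM⟩ := hs.exists_bound_of_continuousOn hφ
  obtain ⟨δ, hδ, h⟩ := Metric.uniformContinuousOn_iff.1
    (hs.uniformContinuousOn_of_continuous hφ) ε hε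
  refine ⟨2 * |M| / δ ^ 2, by positivity, fun x hx y hy => ?_⟩
  rcases lt_or_ge (dist x y) δ with hxy | hxy
  · have := h x hx y hy hxy
    rw [Real.dist_eq] at this
    have : 0 ≤ 2 * |M| / δ ^ 2 * (y - x) ^ 2 := by positivity
    linarith
  · have h1 : |φ x - φ y| ≤ 2 * |M| := by
      have hx' := hM x hx
      have hy' := hM y hy
      rw [Real.norm_eq_abs] at hx' hy'
      linarith [abs_sub (φ x) (φ y), le_abs_self M]
    have h2 : δ ^ 2 ≤ (y - x) ^ 2 := by
      rw [← sq_abs (y - x), abs_sub_comm, ← Real.dist_eq]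
      gcongr
    have h3 : 2 * |M| ≤ 2 * |M| / δ ^ 2 * (y - x) ^ 2 := by
      rw [div_mul_eq_mul_div, le_div_iff₀ (by positivity)]
      gcongr
    linarith

/-- Martingale-type convergence: the laws of the posterior means of `f` given the Bernstein index
converge weakly to the law of `f`. -/
lemma tendsto_sum_integral_bernstein_mul_comp_weightedMean (hf : Measurable f)
    (hf1 : ∀ t, f t ∈ Set.Icc (0 : ℝ) 1) {φ : ℝ → ℝ} (hφ : ContinuousOn φ (Set.Icc 0 1))
    (hφf : Integrable (fun t => φ (f t)) ν) :
    Tendsto (fun n : ℕ => ∑ k : Fin (n + 1),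
      (∫ t, bernstein n k t ∂ν) * φ (weightedMean ν (bernstein n k) f)) atTop
      (𝓝 (∫ t, φ (f t) ∂ν)) := by
  have hfi : Integrable f ν := integrable_of_mem_Icc_zero_one hf hf1
  have hr (n k : ℕ) : weightedMean ν (bernstein n k) f ∈ Set.Icc (0 : ℝ) 1 :=
    weightedMean_mem_Icc (fun t => bernstein_nonneg) (integrable_bernstein n k)
      (integrable_bernstein_mul n k hfi) hf1
  rw [Metric.tendsto_nhds]
  intro ε hε
  set N := ν.real Set.univ with hN
  have hN0 : 0 ≤ N := measureReal_nonneg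
  obtain ⟨C, hC, hφC⟩ := hφ.exists_abs_sub_le_add_mul_sq isCompact_Icc
    (show 0 < ε / (2 * (N + 1)) by positivity)
  have hlim := (tendsto_sum_integral_bernstein_sub_weightedMean_sq (ν := ν) hf hf1).const_mul C
  rw [mul_zero] at hlim
  filter_upwards [hlim.eventually_lt_const (show 0 < ε / 2 by positivity)] with n hn
  have hsq (k : Fin (n + 1)) :
      Integrable (fun t => (f t - weightedMean ν (bernstein n k) f) ^ 2) ν := by
    refine .of_bound ((hf.sub_const _).pow_const 2).aestronglyMeasurable 1 (.of_forall fun t => ?_)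
    rw [Real.norm_of_nonneg (sq_nonneg _), sq_le_one_iff_abs_le_one, abs_le]
    constructor <;> linarith [(hf1 t).1, (hf1 t).2, (hr n k).1, (hr n k).2]
  rw [Real.dist_eq, ← integral_sum_bernstein_mul n hφf, ← Finset.sum_sub_distrib]
  calc |∑ k : Fin (n + 1), ((∫ t, bernstein n k t ∂ν) * φ (weightedMean ν (bernstein n k) f) -
          ∫ t, bernstein n k t * φ (f t) ∂ν)|
      ≤ ∑ k : Fin (n + 1), ((∫ t, bernstein n k t * (ε / (2 * (N + 1))) ∂ν) +
          C * ∫ t, bernstein n k t * (f t - weightedMean ν (bernstein n k) f) ^ 2 ∂ν) := by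
        refine (Finset.abs_sum_le_sum_abs _ _).trans (Finset.sum_le_sum fun k _ => ?_)
        rw [← integral_mul_const, ← integral_sub ((integrable_bernstein n k).mul_const _)
          (integrable_bernstein_mul n k hφf), ← integral_const_mul,
          ← integral_add (integrable_bernstein_mul n k (integrable_const _))
            ((integrable_bernstein_mul n k (hsq k)).const_mul C)]
        rw [← Real.norm_eq_abs]
        refine norm_integral_le_of_norm_le (integrable_bernstein_mul n k (integrable_const _) |>.add
            ((integrable_bernstein_mul n k (hsq k)).const_mul C)) (.of_forall fun t => ?_)
        have hb : 0 ≤ bernstein n k t := bernstein_nonneg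
        rw [← mul_sub, norm_mul, Real.norm_of_nonneg hb, Real.norm_eq_abs]
        have := mul_le_mul_of_nonneg_left (hφC _ (hr n k) _ (hf1 t)) hb
        linarith
    _ = N * (ε / (2 * (N + 1))) + C * ∑ k : Fin (n + 1),
          ∫ t, bernstein n k t * (f t - weightedMean ν (bernstein n k) f) ^ 2 ∂ν := by
        rw [Finset.sum_add_distrib, ← Finset.mul_sum,
          integral_sum_bernstein_mul n (integrable_const _), integral_const, smul_eq_mul]
    _ < ε := by
        have : N * (ε / (2 * (N + 1))) ≤ ε / 2 := by
          rw [mul_div_assoc', div_le_div_iff₀ (by positivity) (by positivity)]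
          nlinarith
        linarith

end Bernstein

/-- The function `x ↦ x ^ α * (1 - x) ^ (1 - α)` with values in `[0, ∞]`. -/
noncomputable def renyiKernel (α x : ℝ) : ℝ≥0∞ :=
  ENNReal.ofReal x ^ α * ENNReal.ofReal (1 - x) ^ (1 - α)

lemma measurable_renyiKernel (α : ℝ) : Measurable (renyiKernel α) := by
  unfold renyiKernel; fun_prop

lemma continuousOn_renyiKernel {α : ℝ} (hα : 0 < α) :
    ContinuousOn (renyiKernel α) (Set.Icc 0 1) := by
  intro x hx
  have h1 : ContinuousAt (fun x : ℝ => ENNReal.ofReal x ^ α) x :=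
    (ENNReal.continuous_rpow_const.comp ENNReal.continuous_ofReal).continuousAt
  have h2 : ContinuousAt (fun x : ℝ => ENNReal.ofReal (1 - x) ^ (1 - α)) x :=
    (ENNReal.continuous_rpow_const.comp
      (ENNReal.continuous_ofReal.comp (by fun_prop : Continuous fun x : ℝ => 1 - x))).continuousAt
  have hx1 : ENNReal.ofReal x ^ α ≠ ⊤ := ENNReal.rpow_ne_top_of_nonneg hα.le ENNReal.ofReal_ne_top
  refine (ENNReal.Tendsto.mul h1 ?_ h2 (.inr hx1)).mono_left nhdsWithin_le_nhds
  rcases hx.2.lt_or_eq with h | rfl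
  · exact .inr (ENNReal.rpow_ne_top_of_ne_zero (by simpa using h) ENNReal.ofReal_ne_top)
  · exact .inl (by simp)

lemma renyiKernel_le_one {α x : ℝ} (hα : 0 < α) (hα1 : α ≤ 1) (hx : x ∈ Set.Icc (0 : ℝ) 1) :
    renyiKernel α x ≤ 1 :=
  mul_le_one' (ENNReal.rpow_le_one (by simpa using hx.2) hα.le)
    (ENNReal.rpow_le_one (by simpa using hx.1) (by linarith))

lemma ENNReal.mul_rpow_mul_mul_rpow_one_sub {α : ℝ} (hα : 0 < α) {c : ℝ≥0∞} (hc : c ≠ ⊤)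
    (x y : ℝ≥0∞) : (c * x) ^ α * (c * y) ^ (1 - α) = c * (x ^ α * y ^ (1 - α)) := by
  rcases eq_or_ne c 0 with rfl | h0
  · simp [hα]
  · rw [ENNReal.mul_rpow_eq_ite, ENNReal.mul_rpow_eq_ite]
    simp only [h0, hc, false_and, or_self, if_false]
    rw [mul_mul_mul_comm, ← ENNReal.rpow_add _ _ h0 hc, add_sub_cancel, ENNReal.rpow_one]

/-- **Hölder's inequality for exponents larger than one**, in the form of the joint convexity of
`(x, y) ↦ x ^ α * y ^ (1 - α)`. -/
lemma rpow_lintegral_mul_rpow_lintegral_le {X : Type*} [MeasurableSpace X] {m : Measure X}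
    {α : ℝ} (hα : 1 < α) {f g : X → ℝ≥0∞} (hf : Measurable f) (hg : Measurable g)
    (hg' : ∀ t, g t ≠ ⊤) :
    (∫⁻ t, f t ∂m) ^ α * (∫⁻ t, g t ∂m) ^ (1 - α) ≤ ∫⁻ t, f t ^ α * g t ^ (1 - α) ∂m := by
  have hα0 : 0 < α := one_pos.trans hα
  have hmeas : Measurable fun t => f t ^ α * g t ^ (1 - α) := by fun_prop
  rcases eq_or_ne (∫⁻ t, f t ^ α * g t ^ (1 - α) ∂m) ⊤ with hI | hI
  · rw [hI]; exact le_top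
  have hpq : α.HolderConjugate (α / (α - 1)) := Real.HolderConjugate.conjExponent hα
  have hle : ∫⁻ t, f t ∂m ≤
      ∫⁻ t, ((fun t => f t * g t ^ ((1 - α) / α)) * fun t => g t ^ ((α - 1) / α)) t ∂m := by
    refine lintegral_mono_ae ?_
    filter_upwards [ae_lt_top hmeas hI] with t ht
    rcases eq_or_ne (g t) 0 with h0 | h0
    · rw [h0, ENNReal.zero_rpow_of_neg (by linarith)] at ht
      have : f t = 0 := by
        by_contra h
        rw [ENNReal.mul_top (by simp [h, hα0.le])] at ht
        exact ht.ne rfl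
      simp [this]
    · rw [Pi.mul_apply, mul_assoc, ← ENNReal.rpow_add _ _ h0 (hg' t), ← add_div]
      simp
  have hold := hle.trans (ENNReal.lintegral_mul_le_Lp_mul_Lq m hpq
    (by fun_prop : Measurable fun t => f t * g t ^ ((1 - α) / α)).aemeasurable
    (by fun_prop : Measurable fun t => g t ^ ((α - 1) / α)).aemeasurable)
  have e1 (t : X) : (f t * g t ^ ((1 - α) / α)) ^ α = f t ^ α * g t ^ (1 - α) := by
    rw [ENNReal.mul_rpow_of_nonneg _ _ hα0.le, ← ENNReal.rpow_mul, div_mul_cancel₀ _ hα0.ne']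
  have e2 (t : X) : (g t ^ ((α - 1) / α)) ^ (α / (α - 1)) = g t := by
    rw [← ENNReal.rpow_mul, div_mul_div_cancel₀ hα0.ne', div_self (by linarith), ENNReal.rpow_one]
  simp_rw [e1, e2] at hold
  have key := ENNReal.rpow_le_rpow hold hα0.le
  rw [ENNReal.mul_rpow_of_nonneg _ _ hα0.le, ← ENNReal.rpow_mul, ← ENNReal.rpow_mul,
    one_div_mul_cancel hα0.ne', ENNReal.rpow_one,
    show 1 / (α / (α - 1)) * α = α - 1 by field_simp] at key
  calc _ ≤ (∫⁻ t, f t ^ α * g t ^ (1 - α) ∂m) * (∫⁻ t, g t ∂m) ^ (α - 1) *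
        (∫⁻ t, g t ∂m) ^ (1 - α) := mul_le_mul_left key _
    _ ≤ (∫⁻ t, f t ^ α * g t ^ (1 - α) ∂m) * 1 := by
        rw [mul_assoc, ← neg_sub α 1, ENNReal.rpow_neg]
        exact mul_le_mul_right (ENNReal.mul_inv_le_one _) _
    _ = _ := mul_one _

section Limit

variable {ν : Measure I} [IsFiniteMeasure ν] {f : I → ℝ}

lemma tendsto_sum_ofReal_integral_bernstein_mul_min (hf : Measurable f)
    (hf1 : ∀ t, f t ∈ Set.Icc (0 : ℝ) 1) {Φ : ℝ → ℝ≥0∞} (hΦm : Measurable Φ)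
    (hΦ : ContinuousOn Φ (Set.Icc 0 1)) {M : ℝ≥0∞} (hM : M ≠ ⊤) :
    Tendsto (fun n : ℕ => ∑ k : Fin (n + 1), ENNReal.ofReal (∫ t, bernstein n k t ∂ν) *
        min (Φ (weightedMean ν (bernstein n k) f)) M) atTop
      (𝓝 (∫⁻ t, min (Φ (f t)) M ∂ν)) := by
  have hne (x : ℝ) : min (Φ x) M ≠ ⊤ := ne_top_of_le_ne_top hM (min_le_right _ _)
  let φ : ℝ → ℝ := fun x => (min (Φ x) M).toReal
  have hφ0 (x : ℝ) : 0 ≤ φ x := ENNReal.toReal_nonneg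
  have hofReal (x : ℝ) : ENNReal.ofReal (φ x) = min (Φ x) M := ENNReal.ofReal_toReal (hne x)
  have hφ : ContinuousOn φ (Set.Icc 0 1) := fun x hx =>
    (ENNReal.tendsto_toReal (hne x)).comp ((hΦ x hx).min tendsto_const_nhds)
  have hφm : Measurable φ := (hΦm.min measurable_const).ennreal_toReal
  have hφf : Integrable (fun t => φ (f t)) ν :=
    .of_bound (hφm.comp hf).aestronglyMeasurable M.toReal (.of_forall fun t => by
      rw [Real.norm_of_nonneg (hφ0 _)]
      exact ENNReal.toReal_mono hM (min_le_right _ _))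
  have hlim := ENNReal.tendsto_ofReal
    (tendsto_sum_integral_bernstein_mul_comp_weightedMean hf hf1 hφ hφf)
  rw [ofReal_integral_eq_lintegral_ofReal hφf (.of_forall fun t => hφ0 _)] at hlim
  simp_rw [hofReal] at hlim
  refine hlim.congr fun n => ?_
  have hW (k : ℕ) : 0 ≤ ∫ t, bernstein n k t ∂ν := integral_nonneg fun t => bernstein_nonneg
  rw [ENNReal.ofReal_sum_of_nonneg fun (k : Fin (n + 1)) _ => mul_nonneg (hW k) (hφ0 _)]
  exact Finset.sum_congr rfl fun k _ => by rw [ENNReal.ofReal_mul (hW k), hofReal]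

lemma lintegral_bernstein_mul_eq (hf : Measurable f) (hf1 : ∀ t, f t ∈ Set.Icc (0 : ℝ) 1)
    (n k : ℕ) :
    ∫⁻ t, ENNReal.ofReal (bernstein n k t) * ENNReal.ofReal (f t) ∂ν =
      ENNReal.ofReal (∫ t, bernstein n k t ∂ν) *
        ENNReal.ofReal (weightedMean ν (bernstein n k) f) := by
  have hW : 0 ≤ ∫ t, bernstein n k t ∂ν := integral_nonneg fun t => bernstein_nonneg
  rw [← ENNReal.ofReal_mul hW, mul_comm (∫ t, _ ∂ν),
    weightedMean_mul_integral (fun t => bernstein_nonneg) (integrable_bernstein n k),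
    ofReal_integral_eq_lintegral_ofReal
      (integrable_bernstein_mul n k (integrable_of_mem_Icc_zero_one hf hf1))
      (.of_forall fun t => mul_nonneg bernstein_nonneg (hf1 t).1)]
  simp_rw [ENNReal.ofReal_mul (bernstein_nonneg : 0 ≤ bernstein n k _)]

lemma lintegral_bernstein_mul_one_sub_eq (hf : Measurable f)
    (hf1 : ∀ t, f t ∈ Set.Icc (0 : ℝ) 1) (n k : ℕ) :
    ∫⁻ t, ENNReal.ofReal (bernstein n k t) * ENNReal.ofReal (1 - f t) ∂ν =
      ENNReal.ofReal (∫ t, bernstein n k t ∂ν) *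
        ENNReal.ofReal (1 - weightedMean ν (bernstein n k) f) := by
  have hfi : Integrable f ν := integrable_of_mem_Icc_zero_one hf hf1
  have h1 : ∀ t, 1 - f t ∈ Set.Icc (0 : ℝ) 1 := fun t =>
    ⟨by linarith [(hf1 t).2], by linarith [(hf1 t).1]⟩
  have hW : 0 ≤ ∫ t, bernstein n k t ∂ν := integral_nonneg fun t => bernstein_nonneg
  rw [lintegral_bernstein_mul_eq (hf.const_sub 1) h1, ← ENNReal.ofReal_mul hW,
    ← ENNReal.ofReal_mul hW, mul_comm, weightedMean_mul_integral (fun t => bernstein_nonneg)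
      (integrable_bernstein n k), mul_one_sub, mul_comm (∫ t, _ ∂ν), weightedMean_mul_integral
      (fun t => bernstein_nonneg) (integrable_bernstein n k),
    ← integral_sub (integrable_bernstein n k) (integrable_bernstein_mul n k hfi)]
  simp_rw [mul_one_sub]

lemma sum_ofReal_integral_bernstein_mul_renyiKernel_le (hf : Measurable f)
    (hf1 : ∀ t, f t ∈ Set.Icc (0 : ℝ) 1) {α : ℝ} (hα : 1 < α) (n : ℕ) :
    ∑ k : Fin (n + 1), ENNReal.ofReal (∫ t, bernstein n k t ∂ν) *
        renyiKernel α (weightedMean ν (bernstein n k) f) ≤ ∫⁻ t, renyiKernel α (f t) ∂ν := by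
  have hb (k : ℕ) : Measurable fun t => ENNReal.ofReal (bernstein n k t) :=
    (bernstein n k).measurable.ennreal_ofReal
  have hK : Measurable fun t => renyiKernel α (f t) := (measurable_renyiKernel α).comp hf
  have hle (k : Fin (n + 1)) : ENNReal.ofReal (∫ t, bernstein n k t ∂ν) *
      renyiKernel α (weightedMean ν (bernstein n k) f) ≤
      ∫⁻ t, ENNReal.ofReal (bernstein n k t) * renyiKernel α (f t) ∂ν := by
    have hold := rpow_lintegral_mul_rpow_lintegral_le
      (m := ν.withDensity fun t => ENNReal.ofReal (bernstein n k t)) hα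
      hf.ennreal_ofReal (hf.const_sub 1).ennreal_ofReal fun t => ENNReal.ofReal_ne_top
    change _ ≤ ∫⁻ t, renyiKernel α (f t) ∂_ at hold
    rw [lintegral_withDensity_eq_lintegral_mul _ (hb k) hf.ennreal_ofReal,
      lintegral_withDensity_eq_lintegral_mul _ (hb k) (hf.const_sub 1).ennreal_ofReal,
      lintegral_withDensity_eq_lintegral_mul _ (hb k) hK] at hold
    simp only [Pi.mul_apply] at hold
    rwa [lintegral_bernstein_mul_eq hf hf1, lintegral_bernstein_mul_one_sub_eq hf hf1,
      ENNReal.mul_rpow_mul_mul_rpow_one_sub (one_pos.trans hα) ENNReal.ofReal_ne_top] at hold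
  refine (Finset.sum_le_sum fun k _ => hle k).trans_eq ?_
  have hm (k : Fin (n + 1)) :
      Measurable fun t => ENNReal.ofReal (bernstein n k t) * renyiKernel α (f t) := (hb k).mul hK
  rw [← lintegral_finsetSum _ fun k _ => hm k]
  refine lintegral_congr fun t => ?_
  rw [← Finset.sum_mul, ← ENNReal.ofReal_sum_of_nonneg fun k _ => bernstein_nonneg,
    bernstein.probability, ENNReal.ofReal_one, one_mul]

lemma tendsto_sum_ofReal_integral_bernstein_mul_renyiKernel (hf : Measurable f)
    (hf1 : ∀ t, f t ∈ Set.Icc (0 : ℝ) 1) {α : ℝ} (hα : 0 < α) :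
    Tendsto (fun n : ℕ => ∑ k : Fin (n + 1), ENNReal.ofReal (∫ t, bernstein n k t ∂ν) *
        renyiKernel α (weightedMean ν (bernstein n k) f)) atTop
      (𝓝 (∫⁻ t, renyiKernel α (f t) ∂ν)) := by
  have hmin {M : ℝ≥0∞} (hM : M ≠ ⊤) := tendsto_sum_ofReal_integral_bernstein_mul_min
    (ν := ν) hf hf1 (measurable_renyiKernel α) (continuousOn_renyiKernel hα) hM
  rcases le_or_gt α 1 with hα1 | hα1
  · have hr (n k : ℕ) : weightedMean ν (bernstein n k) f ∈ Set.Icc (0 : ℝ) 1 :=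
      weightedMean_mem_Icc (fun t => bernstein_nonneg) (integrable_bernstein n k)
        (integrable_bernstein_mul n k (integrable_of_mem_Icc_zero_one hf hf1)) hf1
    have := hmin ENNReal.one_ne_top
    simpa only [min_eq_left (renyiKernel_le_one hα hα1 (hr _ _)),
      min_eq_left (renyiKernel_le_one hα hα1 (hf1 _))] using this
  · refine tendsto_order.2 ⟨fun a ha => ?_, fun a ha => .of_forall fun n =>
      (sum_ofReal_integral_bernstein_mul_renyiKernel_le hf hf1 hα1 n).trans_lt ha⟩
    have hK : Measurable fun t => renyiKernel α (f t) := (measurable_renyiKernel α).comp hf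
    have htrunc : Tendsto (fun M : ℕ => ∫⁻ t, min (renyiKernel α (f t)) M ∂ν) atTop
        (𝓝 (∫⁻ t, renyiKernel α (f t) ∂ν)) := by
      refine lintegral_tendsto_of_tendsto_of_monotone
        (fun M => (hK.min measurable_const).aemeasurable)
        (.of_forall fun t M N hMN => min_le_min_left _ (by exact_mod_cast hMN))
        (.of_forall fun t => ?_)
      have := (tendsto_const_nhds (x := renyiKernel α (f t))).min ENNReal.tendsto_nat_nhds_top
      rwa [min_eq_left le_top] at this
    obtain ⟨M, haM⟩ := (htrunc.eventually_const_lt ha).exists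
    filter_upwards [(hmin (ENNReal.natCast_ne_top M)).eventually_const_lt haM] with n hn
    exact hn.trans_le (Finset.sum_le_sum fun k _ => by gcongr; exact min_le_left _ _)

end Limit

lemma choose_mul_lintegral_eq_lintegral_bernstein (μ : Measure I) (n k : ℕ) :
    (n.choose k : ℝ≥0∞) * ∫⁻ t, ENNReal.ofReal ((t : ℝ) ^ k * (1 - (t : ℝ)) ^ (n - k)) ∂μ =
      ∫⁻ t, ENNReal.ofReal (bernstein n k t) ∂μ := by
  rw [← lintegral_const_mul _ (by fun_prop)]
  refine lintegral_congr fun t => ?_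
  rw [bernstein_apply, mul_assoc, ENNReal.ofReal_mul (Nat.cast_nonneg _), ENNReal.ofReal_natCast]

end Auxiliary

/-- **A classical limit formula for Rényi quantities of mixtures of Bernoulli measures.**
Let `μ₁`, `μ₂` be probability (Borel) measures on `[0,1]`, `α ∈ (0,∞)`, `ν := μ₁ + μ₂`, and
let `f = dμ₁/dν`, `g = dμ₂/dν` be Radon–Nikodym derivatives.  Then, with all quantities in
`[0,+∞]`,
`lim_{n→∞} Σ_{k=0}^{n} C(n,k) (∫ λ^k (1−λ)^{n−k} dμ₁)^α (∫ λ^k (1−λ)^{n−k} dμ₂)^{1−α}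
  = ∫ f^α g^{1−α} dν`. -/
theorem tendsto_binomial_renyi_sum
    (μ₁ μ₂ : Measure (Set.Icc (0 : ℝ) 1))
    [IsProbabilityMeasure μ₁] [IsProbabilityMeasure μ₂]
    (α : ℝ) (hα : 0 < α) :
    Filter.Tendsto
      (fun n : ℕ =>
        ∑ k ∈ Finset.range (n + 1),
          (n.choose k : ℝ≥0∞) *
            (∫⁻ t, ENNReal.ofReal ((t : ℝ) ^ k * (1 - (t : ℝ)) ^ (n - k)) ∂μ₁) ^ α *
            (∫⁻ t, ENNReal.ofReal ((t : ℝ) ^ k * (1 - (t : ℝ)) ^ (n - k)) ∂μ₂) ^ (1 - α))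
      Filter.atTop
      (nhds (∫⁻ t, (μ₁.rnDeriv (μ₁ + μ₂) t) ^ α * (μ₂.rnDeriv (μ₁ + μ₂) t) ^ (1 - α)
        ∂(μ₁ + μ₂))) := by
  set ν := μ₁ + μ₂ with hν
  have : IsFiniteMeasure ν := inferInstanceAs (IsFiniteMeasure (μ₁ + μ₂))
  have : μ₁.HaveLebesgueDecomposition ν := Measure.haveLebesgueDecomposition_of_sigmaFinite _ _
  have : μ₂.HaveLebesgueDecomposition ν := Measure.haveLebesgueDecomposition_of_sigmaFinite _ _
  let F : Set.Icc (0 : ℝ) 1 → ℝ := fun t => min (μ₁.rnDeriv ν t).toReal 1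
  have hF : Measurable F := (Measure.measurable_rnDeriv _ _).ennreal_toReal.min measurable_const
  have hF1 (t) : F t ∈ Set.Icc (0 : ℝ) 1 :=
    ⟨le_min ENNReal.toReal_nonneg zero_le_one, min_le_right _ _⟩
  have hac₁ : μ₁ ≪ ν := Measure.AbsolutelyContinuous.rfl.add_right μ₂
  have hac₂ : μ₂ ≪ ν := by
    rw [hν, add_comm]; exact Measure.AbsolutelyContinuous.rfl.add_right μ₁
  have hsum : ∀ᵐ t ∂ν, μ₁.rnDeriv ν t + μ₂.rnDeriv ν t = 1 := by
    filter_upwards [Measure.rnDeriv_add μ₁ μ₂ ν, Measure.rnDeriv_self ν] with t h1 h2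
    rw [← h2]; exact h1.symm
  have hf : ∀ᵐ t ∂ν, μ₁.rnDeriv ν t = ENNReal.ofReal (F t) := by
    filter_upwards [hsum] with t ht
    have hle : μ₁.rnDeriv ν t ≤ 1 := ht ▸ le_self_add
    simp only [F]
    rw [min_eq_left (ENNReal.toReal_le_of_le_ofReal zero_le_one (by simpa using hle)),
      ENNReal.ofReal_toReal (ne_top_of_le_ne_top ENNReal.one_ne_top hle)]
  have hg : ∀ᵐ t ∂ν, μ₂.rnDeriv ν t = ENNReal.ofReal (1 - F t) := by
    filter_upwards [hsum, hf] with t ht hft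
    rw [ENNReal.ofReal_sub _ (hF1 t).1, ENNReal.ofReal_one, ← ht, ← hft]
    exact (ENNReal.add_sub_cancel_left (hft ▸ ENNReal.ofReal_ne_top)).symm
  have hrhs : ∫⁻ t, (μ₁.rnDeriv ν t) ^ α * (μ₂.rnDeriv ν t) ^ (1 - α) ∂ν =
      ∫⁻ t, renyiKernel α (F t) ∂ν :=
    lintegral_congr_ae (by filter_upwards [hf, hg] with t h1 h2; rw [h1, h2]; rfl)
  rw [hrhs]
  refine (tendsto_sum_ofReal_integral_bernstein_mul_renyiKernel hF hF1 hα).congr fun n => ?_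
  rw [Finset.sum_range]
  refine Finset.sum_congr rfl fun k _ => ?_
  have hb : AEMeasurable (fun t => ENNReal.ofReal (bernstein n k t)) ν :=
    (bernstein n k).measurable.ennreal_ofReal.aemeasurable
  have h₁ : ∫⁻ t, ENNReal.ofReal (bernstein n k t) ∂μ₁ =
      ENNReal.ofReal (∫ t, bernstein n k t ∂ν) *
        ENNReal.ofReal (weightedMean ν (bernstein n k) F) := by
    rw [← lintegral_bernstein_mul_eq hF hF1, ← lintegral_rnDeriv_mul hac₁ hb]
    exact lintegral_congr_ae (by filter_upwards [hf] with t ht; rw [ht, mul_comm])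
  have h₂ : ∫⁻ t, ENNReal.ofReal (bernstein n k t) ∂μ₂ =
      ENNReal.ofReal (∫ t, bernstein n k t ∂ν) *
        ENNReal.ofReal (1 - weightedMean ν (bernstein n k) F) := by
    rw [← lintegral_bernstein_mul_one_sub_eq hF hF1, ← lintegral_rnDeriv_mul hac₂ hb]
    exact lintegral_congr_ae (by filter_upwards [hg] with t ht; rw [ht, mul_comm])
  rw [mul_assoc, ← ENNReal.mul_rpow_mul_mul_rpow_one_sub hα (ENNReal.natCast_ne_top _),
    choose_mul_lintegral_eq_lintegral_bernstein, choose_mul_lintegral_eq_lintegral_bernstein,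
    h₁, h₂, ENNReal.mul_rpow_mul_mul_rpow_one_sub hα ENNReal.ofReal_ne_top, renyiKernel]
end

section
/- Let ρ and σ be density matrices on ℂ^d with s(ρ) ≤ s(σ). Then the function r ↦ H*_r(ρ‖σ) is real-valued (finite) on all of ℝ, monotone nondecreasing, and convex on ℝ; in particular it is continuous on ℝ. -/
open scoped ENNReal ComplexOrder Classical

namespace QRD

open Matrix

section Spectral

variable {n : Type*} [Fintype n] [DecidableEq n]

lemma matFun_isHermitian (A : Matrix n n ℂ) (f : ℝ → ℝ) : (matFun A f).IsHermitian := by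
  unfold matFun
  split_ifs with hA
  · rw [star_eq_conjTranspose]
    refine isHermitian_mul_mul_conjTranspose _ ?_
    exact isHermitian_diagonal_of_self_adjoint _ (by ext i; simp)
  · exact isHermitian_zero

lemma trace_matFun {A : Matrix n n ℂ} (hA : A.IsHermitian) (f : ℝ → ℝ) :
    (matFun A f).trace = ∑ i, (f (hA.eigenvalues i) : ℂ) := by
  rw [matFun, dif_pos hA, trace_mul_comm, ← mul_assoc, Unitary.coe_star_mul_self, one_mul,
    trace_diagonal]

lemma trace_matFun_mul_mul_matFun {σ : Matrix n n ℂ} (hσ : σ.IsHermitian) (ρ : Matrix n n ℂ)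
    (f : ℝ → ℝ) :
    (matFun σ f * ρ * matFun σ f).trace =
      ∑ i, (f (hσ.eigenvalues i) : ℂ) ^ 2 *
        (star (hσ.eigenvectorUnitary : Matrix n n ℂ) * ρ * hσ.eigenvectorUnitary) i i := by
  rw [matFun, dif_pos hσ]
  set U : Matrix n n ℂ := hσ.eigenvectorUnitary.val
  set D : Matrix n n ℂ := diagonal fun i => (f (hσ.eigenvalues i) : ℂ) with hD
  have hUU : star U * U = 1 := Unitary.coe_star_mul_self _
  calc (U * D * star U * ρ * (U * D * star U)).trace
      = (U * (D * (star U * ρ * U) * D * star U)).trace := by simp only [mul_assoc]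
    _ = (D * (star U * ρ * U) * D).trace := by
        rw [trace_mul_comm, mul_assoc, hUU, mul_one]
    _ = _ := by
        simp only [trace, diag_apply, hD, mul_diagonal, diagonal_mul]
        exact Finset.sum_congr rfl fun i _ => by ring

/-- If `s(ρ) ≤ s(σ)` then `ρ` has no weight on the null eigenvectors of `σ`. -/
lemma conj_eigenvectorUnitary_apply_eq_zero {ρ σ : Matrix n n ℂ} (hσ : σ.IsHermitian)
    (hsupp : suppLE ρ σ) {i : n} (hi : hσ.eigenvalues i = 0) :
    (star (hσ.eigenvectorUnitary : Matrix n n ℂ) * ρ * hσ.eigenvectorUnitary) i i = 0 := by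
  have hker : σ *ᵥ (hσ.eigenvectorBasis i).ofLp = 0 := by
    rw [hσ.mulVec_eigenvectorBasis, hi, zero_smul]
  have hker' : ρ *ᵥ (hσ.eigenvectorBasis i).ofLp = 0 :=
    LinearMap.mem_ker.1 (hsupp (LinearMap.mem_ker.2 hker))
  rw [mul_assoc, mul_apply]
  refine Finset.sum_eq_zero fun k _ => ?_
  have : (ρ * (hσ.eigenvectorUnitary : Matrix n n ℂ)) k i = 0 := by
    simpa [mul_apply, mulVec, dotProduct] using congrFun hker' k
  rw [this, mul_zero]

lemma IsDensityMatrix.eigenvalues_le_one {σ : Matrix n n ℂ} (hσ : IsDensityMatrix σ) (i : n) :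
    hσ.1.1.eigenvalues i ≤ 1 := by
  have hsum : ∑ j, hσ.1.1.eigenvalues j = 1 := by
    have h := hσ.1.1.trace_eq_sum_eigenvalues
    simpa using congrArg Complex.re (h.symm.trans hσ.2)
  rw [← hsum]
  exact Finset.single_le_sum (fun j _ => hσ.1.eigenvalues_nonneg j) (Finset.mem_univ i)

/-- Sandwiching `ρ` between nonpositive powers of a density matrix does not decrease the trace. -/
lemma one_le_trace_sandwich {ρ σ : Matrix n n ℂ} (hρ : IsDensityMatrix ρ)
    (hσ : IsDensityMatrix σ) (hsupp : suppLE ρ σ) {t : ℝ} (ht : t ≤ 0) :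
    1 ≤ (matPow σ t * ρ * matPow σ t).trace.re := by
  have hσH := hσ.1.1
  set U : Matrix n n ℂ := hσH.eigenvectorUnitary.val with hU
  have hpos : (star U * ρ * U).PosSemidef := hρ.1.conjTranspose_mul_mul_same U
  have htr : (star U * ρ * U).trace = 1 := by
    have hUU : U * star U = 1 := Unitary.coe_mul_star_self _
    rw [trace_mul_comm, ← mul_assoc, hUU, one_mul, hρ.2]
  have hre : ∑ i, ((star U * ρ * U) i i).re = 1 := by
    simpa [trace] using congrArg Complex.re htr
  rw [matPow, trace_matFun_mul_mul_matFun hσH, Complex.re_sum, ← hre]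
  refine Finset.sum_le_sum fun i _ => ?_
  rw [← Complex.ofReal_pow, Complex.re_ofReal_mul]
  by_cases hi : hσH.eigenvalues i = 0
  · rw [hU, conj_eigenvectorUnitary_apply_eq_zero hσH hsupp hi]
    simp
  · rw [if_neg hi]
    have hlam : 0 < hσH.eigenvalues i := (hσ.1.eigenvalues_nonneg i).lt_of_ne' hi
    have h1 : 1 ≤ hσH.eigenvalues i ^ t :=
      Real.one_le_rpow_of_pos_of_le_one_of_nonpos hlam (hσ.eigenvalues_le_one i) ht
    have h0 : 0 ≤ ((star U * ρ * U) i i).re := (Complex.nonneg_iff.1 hpos.diag_nonneg).1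
    exact le_mul_of_one_le_left h0 (one_le_pow₀ h1)

/-- A positive semidefinite matrix of trace at least one has an eigenvalue at least `1 / |n|`, so
its `α`-th power has trace at least `|n|⁻ᵅ`. -/
lemma inv_card_rpow_le_trace_matPow {A : Matrix n n ℂ} (hA : A.PosSemidef)
    (htr : 1 ≤ A.trace.re) {α : ℝ} (hα : 0 ≤ α) :
    ((Fintype.card n : ℝ)⁻¹) ^ α ≤ (matPow A α).trace.re := by
  have hsum : 1 ≤ ∑ i, hA.1.eigenvalues i := by
    rw [hA.1.trace_eq_sum_eigenvalues] at htr
    simpa using htr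
  have hn : Nonempty n := by
    by_contra hn
    rw [not_nonempty_iff] at hn
    simp at hsum
    linarith
  have hcard : (0 : ℝ) < Fintype.card n := by exact_mod_cast Fintype.card_pos
  obtain ⟨i, -, hi⟩ : ∃ i ∈ Finset.univ, (Fintype.card n : ℝ)⁻¹ ≤ hA.1.eigenvalues i := by
    refine Finset.exists_le_of_sum_le Finset.univ_nonempty ?_
    simpa [hcard.ne'] using hsum
  have hi0 : 0 < hA.1.eigenvalues i := (inv_pos.2 hcard).trans_le hi
  rw [matPow, trace_matFun hA.1, Complex.re_sum]
  simp only [Complex.ofReal_re]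
  calc ((Fintype.card n : ℝ)⁻¹) ^ α ≤ hA.1.eigenvalues i ^ α :=
        Real.rpow_le_rpow (inv_pos.2 hcard).le hi hα
    _ = if hA.1.eigenvalues i = 0 then 0 else hA.1.eigenvalues i ^ α := by rw [if_neg hi0.ne']
    _ ≤ _ := by
        refine Finset.single_le_sum
          (f := fun i => if hA.1.eigenvalues i = 0 then 0 else hA.1.eigenvalues i ^ α)
          (fun j _ => ?_) (Finset.mem_univ i)
        split_ifs
        · exact le_rfl
        · exact Real.rpow_nonneg (hA.eigenvalues_nonneg j) _

lemma exists_Qstar_eq_ofReal {ρ σ : Matrix n n ℂ} (hρ : IsDensityMatrix ρ)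
    (hσ : IsDensityMatrix σ) (hsupp : suppLE ρ σ) {α : ℝ} (hα : 1 < α) :
    ∃ q : ℝ, 0 < q ∧ Qstar α ρ σ = ENNReal.ofReal q ∧
      -Real.log q / α ≤ Real.log (Fintype.card n) := by
  have hα0 : 0 < α := one_pos.trans hα
  have ht : (1 - α) / (2 * α) ≤ 0 :=
    div_nonpos_of_nonpos_of_nonneg (by linarith) (by linarith)
  set B := matPow σ ((1 - α) / (2 * α))
  have hBH : Bᴴ = B := matFun_isHermitian _ _
  have hA : (B * ρ * B).PosSemidef := by
    simpa only [hBH] using hρ.1.mul_mul_conjTranspose_same B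
  have hle := inv_card_rpow_le_trace_matPow hA (one_le_trace_sandwich hρ hσ hsupp ht) hα0.le
  have hn : Nonempty n := by
    by_contra hn
    rw [not_nonempty_iff] at hn
    simpa [trace] using hρ.2
  have hcard : (0 : ℝ) < Fintype.card n := by exact_mod_cast Fintype.card_pos
  have hpow : 0 < ((Fintype.card n : ℝ)⁻¹) ^ α := Real.rpow_pos_of_pos (inv_pos.2 hcard) _
  refine ⟨_, hpow.trans_le hle, by rw [Qstar, if_neg fun h => h.2 hsupp], ?_⟩
  have hlog := Real.log_le_log hpow hle
  rw [Real.log_rpow (inv_pos.2 hcard), Real.log_inv] at hlog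
  rw [div_le_iff₀ hα0]
  linarith

end Spectral

lemma mul_sub_Dstar_eq_coe {n : Type*} [Fintype n] [DecidableEq n] {ρ σ : Matrix n n ℂ} {α q : ℝ}
    (hα : 1 < α) (hq : 0 < q) (hQ : Qstar α ρ σ = ENNReal.ofReal q) (r : ℝ) :
    (((α - 1) / α : ℝ) : EReal) * ((r : EReal) - Dstar α ρ σ) =
      (((α - 1) / α * r + -Real.log q / α : ℝ) : EReal) := by
  rw [Dstar, hQ, ENNReal.log_ofReal_of_pos hq]
  norm_cast
  have : α - 1 ≠ 0 := by linarith
  have : α ≠ 0 := by linarith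
  field_simp
  ring

/-- A pointwise bounded supremum of affine functions with nonnegative slopes is monotone and
convex. -/
lemma ciSup_affine_monotone_convexOn {ι : Type*} [Nonempty ι] {a b : ι → ℝ}
    (ha : ∀ i, 0 ≤ a i) (hbdd : ∀ r : ℝ, BddAbove (Set.range fun i => a i * r + b i)) :
    Monotone (fun r => ⨆ i, (a i * r + b i)) ∧
      ConvexOn ℝ Set.univ (fun r => ⨆ i, (a i * r + b i)) := by
  refine ⟨fun r s hrs => ciSup_mono (hbdd s) fun i => ?_, convex_univ, ?_⟩
  · have := mul_le_mul_of_nonneg_left hrs (ha i)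
    linarith
  · intro x _ y _ s t hs ht hst
    refine ciSup_le fun i => ?_
    have hx := mul_le_mul_of_nonneg_left (le_ciSup (hbdd x) i) hs
    have hy := mul_le_mul_of_nonneg_left (le_ciSup (hbdd y) i) ht
    simp only [smul_eq_mul] at hx hy ⊢
    calc a i * (s * x + t * y) + b i
        = s * (a i * x + b i) + t * (a i * y + b i) := by
          linear_combination -(b i) * hst
      _ ≤ _ := add_le_add hx hy

lemma iSup_coe_eq_coe_ciSup {ι : Type*} [Nonempty ι] {f : ι → ℝ}
    (hf : BddAbove (Set.range f)) : (⨆ i, (f i : EReal)) = ((⨆ i, f i : ℝ) : EReal) :=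
  (Monotone.map_ciSup_of_continuousAt continuous_coe_real_ereal.continuousAt
    (fun _ _ h => EReal.coe_le_coe_iff.2 h) hf).symm

end QRD

open QRD in
/-- **Regularity of the Hoeffding anti-divergence in `r`.**  For density matrices `ρ`, `σ`
on `ℂ^d` with `s(ρ) ≤ s(σ)`, the function `r ↦ H*_r(ρ‖σ)` is real-valued (finite) on all
of `ℝ`, monotone nondecreasing and convex; in particular it is continuous on `ℝ`. -/
theorem hoeffdingAntiDivergence_finite_monotone_convex_continuous
    {d : ℕ} (ρ σ : Matrix (Fin d) (Fin d) ℂ)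
    (hρ : IsDensityMatrix ρ) (hσ : IsDensityMatrix σ)
    (hsupp : suppLE ρ σ) :
    ∃ h : ℝ → ℝ,
      (∀ r : ℝ, Hstar r ρ σ = ((h r : ℝ) : EReal)) ∧
      Monotone h ∧ ConvexOn ℝ Set.univ h ∧ Continuous h := by
  have : Nonempty (Set.Ioi (1 : ℝ)) := ⟨⟨2, Set.mem_Ioi.2 one_lt_two⟩⟩
  choose q hq0 hQ hbound using fun α : Set.Ioi (1 : ℝ) =>
    exists_Qstar_eq_ofReal hρ hσ hsupp α.2
  let a : Set.Ioi (1 : ℝ) → ℝ := fun α => ((α : ℝ) - 1) / α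
  let b : Set.Ioi (1 : ℝ) → ℝ := fun α => -Real.log (q α) / α
  have hα (α : Set.Ioi (1 : ℝ)) : (1 : ℝ) < α := α.2
  have ha0 (α) : 0 ≤ a α := div_nonneg (by linarith [hα α]) (by linarith [hα α])
  have ha1 (α) : a α ≤ 1 := (div_le_one (by linarith [hα α])).2 (by linarith)
  have hbdd (r : ℝ) : BddAbove (Set.range fun α => a α * r + b α) := by
    refine ⟨|r| + Real.log (Fintype.card (Fin d)), ?_⟩
    rintro _ ⟨α, rfl⟩
    refine add_le_add ?_ (hbound α)
    exact (mul_le_mul_of_nonneg_left (le_abs_self r) (ha0 α)).trans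
      (mul_le_of_le_one_left (abs_nonneg r) (ha1 α))
  obtain ⟨hmono, hconv⟩ := ciSup_affine_monotone_convexOn ha0 hbdd
  refine ⟨_, fun r => ?_, hmono, hconv, continuousOn_univ.1 (hconv.continuousOn isOpen_univ)⟩
  rw [Hstar, iSup_subtype', ← iSup_coe_eq_coe_ciSup (hbdd r)]
  exact iSup_congr fun α => mul_sub_Dstar_eq_coe (hα α) (hq0 α) (hQ α) r
end
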